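/- arXiv:2502.12357 — 2 statements merged into one kernel-verified Lean document; each statement's English description precedes it below -/
import Mathlib

section
/- Let D be a Prüfer domain that is a ℚ-algebra. Assume there exists y ∈ D such that for every maximal ideal 𝔪 of D, the element y generates the maximal ideal of the localization D_𝔪 (that is, y·D_𝔪 = 𝔪·D_𝔪). Then D is universally Japanese if and only if D_𝔪 is N-2 for every maximal ideal 𝔪 of D. -/
set_option synthInstance.maxHeartbeats 400000
set_option maxHeartbeats 800000

universe u

/-- An integral domain `S` is N-1 if the integral closure of `S` in its fraction
field is a finitely generated `S`-module. -/
def IsN1 (S : Type u) [CommRing S] [IsDomain S] : Prop :=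
  Module.Finite S (integralClosure S (FractionRing S))

/-- An integral domain `S` is N-2 (Japanese) if for every finite field extension `L`
of its fraction field, the integral closure of `S` in `L` is a finitely generated
`S`-module. -/
def IsN2 (S : Type u) [CommRing S] [IsDomain S] : Prop :=
  ∀ (L : Type u) [Field L] [Algebra S L] [Algebra (FractionRing S) L]
    [IsScalarTower S (FractionRing S) L],
    FiniteDimensional (FractionRing S) L → Module.Finite S (integralClosure S L)

/-- A commutative ring `R` is universally Japanese if every finite type `R`-algebra
that is an integral domain is N-1. -/
def UniversallyJapanese (R : Type u) [CommRing R] : Prop :=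
  ∀ (A : Type u) [CommRing A] [IsDomain A] [Algebra R A],
    Algebra.FiniteType R A → IsN1 A

/-- A Prüfer domain is an integral domain whose localization at every prime ideal
is a valuation ring. -/
def IsPruferDomain (D : Type u) [CommRing D] [IsDomain D] : Prop :=
  ∀ (P : Ideal D) [P.IsPrime], ValuationRing (Localization.AtPrime P)

open MvPolynomial

theorem Submodule.mem_of_forall_isMaximal {D M : Type*} [CommRing D] [AddCommGroup M] [Module D M]
    (N : Submodule D M) (x : M)
    (h : ∀ m : Ideal D, m.IsMaximal → ∃ s ∉ m, s • x ∈ N) : x ∈ N := by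
  let I : Ideal D := N.comap (LinearMap.toSpanSingleton D M x)
  have hI : I = ⊤ := by
    by_contra hne
    obtain ⟨m, hm, hle⟩ := Ideal.exists_le_maximal I hne
    obtain ⟨s, hs, hsx⟩ := h m hm
    exact hs (hle (by simpa [I] using hsx))
  have h1 : (1 : D) ∈ I := hI ▸ Submodule.mem_top
  simpa [I] using h1

theorem Ideal.eq_top_of_forall_isMaximal {D : Type*} [CommRing D] (I : Ideal D)
    (h : ∀ m : Ideal D, m.IsMaximal → ∃ s ∉ m, s ∈ I) : I = ⊤ :=
  (Ideal.eq_top_iff_one I).2 <| Submodule.mem_of_forall_isMaximal I 1 fun m hm => by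
    simpa using h m hm

theorem dvd_of_forall_isMaximal {D : Type*} [CommRing D] {a b : D}
    (h : ∀ m : Ideal D, m.IsMaximal → ∃ s ∉ m, a ∣ s * b) : a ∣ b := by
  rw [← Ideal.mem_span_singleton]
  exact Submodule.mem_of_forall_isMaximal _ b fun m hm => by
    simpa [Ideal.mem_span_singleton] using h m hm

theorem natCast_notMem_of_isMaximal {D : Type*} [CommRing D] [Algebra ℚ D] (m : Ideal D)
    (hm : m.IsMaximal) {n : ℕ} (hn : n ≠ 0) : (n : D) ∉ m := by
  intro h
  refine hm.ne_top (Ideal.eq_top_of_isUnit_mem _ h ?_)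
  have := (IsUnit.mk0 (n : ℚ) (by exact_mod_cast hn)).map (algebraMap ℚ D)
  simpa using this

/-- Elementwise form of: at every maximal ideal `m` the localization of the domain `D` is a
valuation ring whose maximal ideal is generated by `y` and whose value group is divisible modulo
the subgroup generated by the value of `y`. -/
structure DivisiblePrufer (D : Type*) [CommRing D] (y : D) : Prop where
  total : ∀ m : Ideal D, m.IsMaximal → ∀ a b : D, ∃ s ∉ m, a ∣ s * b ∨ b ∣ s * a
  mem : ∀ m : Ideal D, m.IsMaximal → y ∈ m
  unif : ∀ m : Ideal D, m.IsMaximal → ∀ a ∈ m, ∃ s ∉ m, y ∣ s * a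
  root : ∀ m : Ideal D, m.IsMaximal → ∀ a : D, a ≠ 0 → ∀ n : ℕ, 0 < n →
    ∃ s ∉ m, ∃ t ∉ m, ∃ (j : ℕ) (b : D), s * a = t * (y ^ j * b ^ n)

namespace DivisiblePrufer

section Ring

variable {D : Type*} [CommRing D] {y : D}

theorem exists_dvd_sub (h : DivisiblePrufer D y) (a : D) : ∃ b, y ∣ a - a ^ 2 * b := by
  have key : a ∈ Ideal.span {a ^ 2, y} := by
    refine Submodule.mem_of_forall_isMaximal _ a fun m hm => ?_
    by_cases ha : a ∈ m
    · obtain ⟨s, hs, c, hc⟩ := h.unif m hm a ha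
      exact ⟨s, hs, Ideal.mem_span_pair.2 ⟨0, c, by rw [smul_eq_mul, hc]; ring⟩⟩
    · exact ⟨a, ha, Ideal.mem_span_pair.2 ⟨1, 0, by rw [smul_eq_mul]; ring⟩⟩
  obtain ⟨b, c, hbc⟩ := Ideal.mem_span_pair.1 key
  exact ⟨b, c, by linear_combination -hbc⟩

theorem exists_indicator (h : DivisiblePrufer D y) (a : D) :
    ∃ e : D, ∀ m : Ideal D, m.IsMaximal → (a ∈ m → e ∈ m) ∧ (a ∉ m → 1 - e ∈ m) := by
  obtain ⟨b, hb⟩ := h.exists_dvd_sub a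
  refine ⟨a * b, fun m hm => ⟨fun ha => m.mul_mem_right _ ha, fun ha => ?_⟩⟩
  have h1 : a * (1 - a * b) ∈ m := by
    have := m.mem_of_dvd hb (h.mem m hm)
    convert this using 1; ring
  exact (hm.isPrime.mem_or_mem h1).resolve_left ha

theorem dvd_iff (h : DivisiblePrufer D y) {a : D} :
    y ∣ a ↔ ∀ m : Ideal D, m.IsMaximal → a ∈ m :=
  ⟨fun ha m hm => m.mem_of_dvd ha (h.mem m hm),
    fun ha => dvd_of_forall_isMaximal fun m hm => h.unif m hm a (ha m hm)⟩

/-- Glueing along the Boolean space of maximal ideals. -/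
theorem patch (h : DivisiblePrufer D y) {X : Type*} [AddCommGroup X] [Module D X]
    (good : X → Ideal D → Prop)
    (hcongr : ∀ m : Ideal D, m.IsMaximal → ∀ x x' : X, x - x' ∈ m • (⊤ : Submodule D X) →
      good x' m → good x m)
    (hloc : ∀ m : Ideal D, m.IsMaximal → ∃ x : X, ∃ a ∉ m,
      ∀ m' : Ideal D, m'.IsMaximal → a ∉ m' → good x m') :
    ∃ x : X, ∀ m : Ideal D, m.IsMaximal → good x m := by
  classical
  let T : Set D := {a | ∃ x : X, ∀ m' : Ideal D, m'.IsMaximal → a ∉ m' → good x m'}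
  have hT : (1 : D) ∈ Ideal.span T := by
    rw [← Ideal.eq_top_iff_one]
    refine Ideal.eq_top_of_forall_isMaximal _ fun m hm => ?_
    obtain ⟨x, a, ha, hx⟩ := hloc m hm
    exact ⟨a, ha, Ideal.subset_span ⟨x, hx⟩⟩
  obtain ⟨F, hFT, hF⟩ := Submodule.mem_span_finite_of_mem_span hT
  suffices H : ∀ F : Finset D, (F : Set D) ⊆ T →
      ∃ x : X, ∀ m : Ideal D, m.IsMaximal → (∃ a ∈ F, a ∉ m) → good x m by
    obtain ⟨x, hx⟩ := H F hFT
    refine ⟨x, fun m hm => hx m hm ?_⟩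
    by_contra! hcon
    exact hm.ne_top ((Ideal.eq_top_iff_one m).2 (Ideal.span_le.2 hcon hF))
  intro F
  induction F using Finset.induction_on with
  | empty => exact fun _ => ⟨0, by simp⟩
  | insert a F _ ih =>
    intro hsub
    obtain ⟨x, hx⟩ := ih fun b hb => hsub (by simp [Finset.mem_coe.1 hb])
    obtain ⟨x', hx'⟩ := hsub (Finset.mem_coe.2 (Finset.mem_insert_self a F))
    obtain ⟨e, he⟩ := h.exists_indicator a
    refine ⟨e • x' + (1 - e) • x, fun m hm hex => ?_⟩
    by_cases ha : a ∈ m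
    · refine hcongr m hm _ x ?_ (hx m hm ?_)
      · have : e • x' + (1 - e) • x - x = e • (x' - x) := by
          rw [sub_smul, one_smul, smul_sub]; abel
        rw [this]
        exact Submodule.smul_mem_smul ((he m hm).1 ha) Submodule.mem_top
      · obtain ⟨b, hb, hbm⟩ := hex
        rcases Finset.mem_insert.1 hb with rfl | hb
        · exact absurd ha hbm
        · exact ⟨b, hb, hbm⟩
    · refine hcongr m hm _ x' ?_ (hx' m hm ha)
      have : e • x' + (1 - e) • x - x' = (1 - e) • (x - x') := by
        simp only [sub_smul, one_smul, smul_sub]; abel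
      rw [this]
      exact Submodule.smul_mem_smul ((he m hm).2 ha) Submodule.mem_top

theorem exists_dvd_all (h : DivisiblePrufer D y) (m : Ideal D) (hm : m.IsMaximal) {ι : Type*}
    (s : Finset ι) (hs : s.Nonempty) (a : ι → D) :
    ∃ i ∈ s, ∃ t ∉ m, ∀ j ∈ s, a i ∣ t * a j := by
  classical
  induction hs using Finset.Nonempty.cons_induction with
  | singleton i =>
    exact ⟨i, by simp, 1, (Ideal.ne_top_iff_one m).1 hm.ne_top, by simp⟩
  | cons i s hi hs ih =>
    obtain ⟨k, hk, t, ht, hdvd⟩ := ih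
    obtain ⟨r, hr, hr'⟩ := h.total m hm (a i) (a k)
    rcases hr' with hik | hki
    · refine ⟨i, by simp, r * t, fun hh => (hm.isPrime.mem_or_mem hh).elim hr ht, ?_⟩
      intro j hj
      rcases Finset.mem_cons.1 hj with rfl | hj
      · exact dvd_mul_left _ _
      · rw [mul_assoc]
        exact hik.trans (mul_dvd_mul_left r (hdvd j hj))
    · refine ⟨k, by simp [hk], r * t, fun hh => (hm.isPrime.mem_or_mem hh).elim hr ht, ?_⟩
      intro j hj
      rcases Finset.mem_cons.1 hj with rfl | hj
      · rw [mul_right_comm]; exact hki.mul_right _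
      · rw [mul_assoc]
        exact (hdvd j hj).mul_left r

end Ring

end DivisiblePrufer

theorem MvPolynomial.notMem_map_C_iff {D σ : Type*} [CommRing D] {m : Ideal D}
    {f : MvPolynomial σ D} : f ∉ m.map (C : D →+* MvPolynomial σ D) ↔ ∃ α, coeff α f ∉ m := by
  rw [MvPolynomial.mem_map_C_iff]; push Not; rfl

theorem MvPolynomial.isPrime_map_C {D σ : Type*} [CommRing D] (m : Ideal D) [hm : m.IsPrime] :
    (m.map (C : D →+* MvPolynomial σ D)).IsPrime := by
  have : m.map (C : D →+* MvPolynomial σ D) =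
      RingHom.ker (MvPolynomial.map (σ := σ) (Ideal.Quotient.mk m)) := by
    rw [MvPolynomial.ker_map, Ideal.mk_ker]
  rw [this]
  exact RingHom.ker_isPrime _

/-- The polynomials whose coefficients generate the unit ideal. -/
def MvPolynomial.unimodular (σ D : Type*) [CommRing D] : Submonoid (MvPolynomial σ D) where
  carrier := {f | ∀ m : Ideal D, m.IsMaximal → f ∉ m.map (C : D →+* MvPolynomial σ D)}
  one_mem' m hm h1 := (MvPolynomial.isPrime_map_C m (hm := hm.isPrime)).ne_top
    ((Ideal.eq_top_iff_one _).2 h1)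
  mul_mem' {_f _g} hf hg m hm hfg :=
    ((MvPolynomial.isPrime_map_C m (hm := hm.isPrime)).mem_or_mem hfg).elim (hf m hm) (hg m hm)

theorem MvPolynomial.ne_zero_of_mem_unimodular {σ D : Type*} [CommRing D] [Nontrivial D]
    {f : MvPolynomial σ D} (hf : f ∈ unimodular σ D) : f ≠ 0 := by
  rintro rfl
  obtain ⟨m, hm⟩ := Ideal.exists_maximal D
  exact hf m hm (Ideal.zero_mem _)

namespace DivisiblePrufer

section Domain

variable {D : Type*} [CommRing D] [IsDomain D] {y : D}

/-- Extracting the content of a vector of polynomials locally at a maximal ideal. -/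
theorem exists_content_pi (h : DivisiblePrufer D y) (m : Ideal D) (hm : m.IsMaximal)
    {σ : Type*} {r : ℕ} (x : Fin r → MvPolynomial σ D) (hx : x ≠ 0) :
    ∃ s ∉ m, ∃ c : D, c ≠ 0 ∧ ∃ x' : Fin r → MvPolynomial σ D,
      (∃ i α, coeff α (x' i) ∉ m) ∧
        (C s : MvPolynomial σ D) • x = (C c : MvPolynomial σ D) • x' := by
  classical
  let P : Finset (Σ _ : Fin r, σ →₀ ℕ) := Finset.univ.sigma fun i => (x i).support
  have hP : P.Nonempty := by
    obtain ⟨i, hi⟩ := Function.ne_iff.1 hx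
    obtain ⟨α, hα⟩ := MvPolynomial.ne_zero_iff.1 hi
    exact ⟨⟨i, α⟩, by simpa [P] using hα⟩
  obtain ⟨⟨i, α⟩, hi, t, ht, hdvd⟩ := h.exists_dvd_all m hm P hP fun p => coeff p.2 (x p.1)
  have hdvd' : ∀ j β, coeff α (x i) ∣ t * coeff β (x j) := by
    intro j β
    by_cases hz : coeff β (x j) = 0
    · simp [hz]
    · exact hdvd ⟨j, β⟩ (by simpa [P] using hz)
  have hc : coeff α (x i) ≠ 0 := by simpa [P] using hi
  have hC : ∀ j, ∃ g : MvPolynomial σ D, C t * x j = C (coeff α (x i)) * g := fun j =>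
    (C_dvd_iff_dvd_coeff (coeff α (x i)) (C t * x j)).2 fun β => by
      rw [coeff_C_mul]; exact hdvd' j β
  choose g hg using hC
  refine ⟨t, ht, _, hc, g, ⟨i, α, ?_⟩, funext fun j => by simpa using hg j⟩
  have e1 := congrArg (coeff α) (hg i)
  rw [coeff_C_mul, coeff_C_mul, mul_comm t] at e1
  rwa [← mul_left_cancel₀ hc e1]

theorem exists_content (h : DivisiblePrufer D y) (m : Ideal D) (hm : m.IsMaximal)
    {σ : Type*} (f : MvPolynomial σ D) (hf : f ≠ 0) :
    ∃ s ∉ m, ∃ c : D, c ≠ 0 ∧ ∃ g : MvPolynomial σ D,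
      (∃ α, coeff α g ∉ m) ∧ C s * f = C c * g := by
  obtain ⟨s, hs, c, hc, x', ⟨i, α, hi⟩, e⟩ :=
    h.exists_content_pi m hm (fun _ : Fin 1 => f) (fun H => hf (congrFun H 0))
  exact ⟨s, hs, c, hc, x' i, ⟨α, hi⟩, congrFun e i⟩

theorem C_dvd_of_dvd_mul (h : DivisiblePrufer D y) {σ : Type*} {f p : MvPolynomial σ D} {c : D}
    (hf : f ∈ unimodular σ D) (hd : C c ∣ f * p) : C c ∣ p := by
  by_cases hp : p = 0
  · simp [hp]
  rw [C_dvd_iff_dvd_coeff]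
  intro α
  refine dvd_of_forall_isMaximal fun m hm => ?_
  have hprime := MvPolynomial.isPrime_map_C (σ := σ) m (hm := hm.isPrime)
  obtain ⟨s, hs, c', hc', g, hg, e⟩ := h.exists_content m hm p hp
  have hfg : f * g ∉ m.map (C : D →+* MvPolynomial σ D) := fun H =>
    (hprime.mem_or_mem H).elim (hf m hm) (notMem_map_C_iff.2 hg)
  obtain ⟨β, hβ⟩ := notMem_map_C_iff.1 hfg
  have h1 : C c ∣ C c' * (f * g) := by
    have : C c' * (f * g) = C s * (f * p) := by linear_combination -f * e
    rw [this]; exact hd.mul_left _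
  rw [C_dvd_iff_dvd_coeff] at h1
  have h2 := h1 β
  rw [coeff_C_mul] at h2
  refine ⟨coeff β (f * g) * s, fun H => (hm.isPrime.mem_or_mem H).elim hβ hs, ?_⟩
  have e2 := congrArg (coeff α) e
  rw [coeff_C_mul, coeff_C_mul] at e2
  have : coeff β (f * g) * s * coeff α p = c' * coeff β (f * g) * coeff α g := by
    linear_combination coeff β (f * g) * e2
  rw [this]; exact h2.mul_right _

theorem isIntegrallyClosed (h : DivisiblePrufer D y) : IsIntegrallyClosed D := by
  rw [isIntegrallyClosed_iff (FractionRing D)]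
  intro x hx
  obtain ⟨a, b, hb, rfl⟩ := IsFractionRing.div_surjective (A := D) x
  have hb0 : b ≠ 0 := nonZeroDivisors.ne_zero hb
  have hb' : algebraMap D (FractionRing D) b ≠ 0 := by simpa using hb0
  obtain ⟨p, hp, hroot⟩ := hx
  -- `b` divides `a` up to elements outside of each maximal ideal
  have hdvd : b ∣ a := by
    refine dvd_of_forall_isMaximal fun m hm => ?_
    obtain ⟨s, hs, hab | hba⟩ := h.total m hm a b
    · obtain ⟨c, hc⟩ := hab
      have ha0 : a ≠ 0 := by
        rintro rfl
        have : s = 0 := by simpa [hb0] using hc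
        exact hs (this ▸ m.zero_mem)
      have hcm : c ∉ m := fun hcm => hs <| by
        have hx : algebraMap D (FractionRing D) c *
            (algebraMap D (FractionRing D) a / algebraMap D _ b) = algebraMap D _ s := by
          have := congrArg (algebraMap D (FractionRing D)) hc
          rw [map_mul, map_mul] at this
          field_simp
          linear_combination -this
        have hs' := Polynomial.scaleRoots_aeval_eq_zero (r := c) (p := p)
          (show Polynomial.aeval (algebraMap D (FractionRing D) a / algebraMap D _ b) p = 0 by
            rw [Polynomial.aeval_def]; exact hroot)
        rw [hx, Polynomial.aeval_algebraMap_apply, FaithfulSMul.algebraMap_eq_zero_iff,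
          Polynomial.aeval_def, Algebra.algebraMap_self, Polynomial.eval₂_id,
          Polynomial.eval_eq_sum_range, Finset.sum_range_succ, Polynomial.natDegree_scaleRoots,
          Polynomial.coeff_scaleRoots_natDegree, hp.leadingCoeff, one_mul] at hs'
        refine hm.isPrime.mem_of_pow_mem p.natDegree ?_
        rw [eq_neg_of_add_eq_zero_right hs']
        refine m.neg_mem (m.sum_mem fun i hi => m.mul_mem_right _ ?_)
        rw [Polynomial.coeff_scaleRoots]
        exact m.mul_mem_left _ (m.pow_mem_of_mem hcm _ (by have := Finset.mem_range.1 hi; lia))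
      exact ⟨c, hcm, s, by linear_combination -hc⟩
    · exact ⟨s, hs, hba⟩
  obtain ⟨c, rfl⟩ := hdvd
  exact ⟨c, by rw [map_mul]; field_simp⟩

end Domain

section MvPolynomial

variable {D : Type*} [CommRing D] {y : D}

theorem dvd_of_dvd_sq_mvPolynomial (h : DivisiblePrufer D y) {σ : Type*} {f : MvPolynomial σ D}
    {n : ℕ} (hf : C y ∣ f ^ n) : C y ∣ f := by
  rw [C_dvd_iff_dvd_coeff]
  intro α
  refine h.dvd_iff.2 fun m hm => ?_
  have hprime := MvPolynomial.isPrime_map_C (σ := σ) m (hm := hm.isPrime)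
  exact mem_map_C_iff.1 (hprime.mem_of_pow_mem n
    (Ideal.mem_of_dvd _ hf (Ideal.mem_map_of_mem C (h.mem m hm)))) α

/-- An ideal of the polynomial ring not contained in any `m D[z]` contains a unimodular
polynomial. -/
theorem exists_mem_unimodular (h : DivisiblePrufer D y) {σ : Type*} (q : Ideal (MvPolynomial σ D))
    (hq : ∀ m : Ideal D, m.IsMaximal → ∃ f ∈ q, f ∉ m.map (C : D →+* MvPolynomial σ D)) :
    ∃ f ∈ q, f ∈ unimodular σ D := by
  suffices H : ∃ f : q, ∀ m : Ideal D, m.IsMaximal →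
      (f : MvPolynomial σ D) ∉ m.map (C : D →+* MvPolynomial σ D) by
    obtain ⟨f, hf⟩ := H
    exact ⟨f, f.2, hf⟩
  refine h.patch (X := q)
    (fun f m => (f : MvPolynomial σ D) ∉ m.map (C : D →+* MvPolynomial σ D)) ?_ ?_
  · intro m hm x x' hxx hx' hx
    refine hx' ?_
    have : ((x - x' : q) : MvPolynomial σ D) ∈ m.map (C : D →+* MvPolynomial σ D) := by
      refine Submodule.smul_induction_on hxx (fun r hr n _ => ?_) fun a b ha hb => ?_
      · rw [Submodule.coe_smul_of_tower, MvPolynomial.smul_eq_C_mul]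
        exact Ideal.mul_mem_right _ _ (Ideal.mem_map_of_mem C hr)
      · exact Ideal.add_mem _ ha hb
    have := Ideal.sub_mem _ hx this
    simpa using this
  · intro m hm
    obtain ⟨f, hfq, hf⟩ := hq m hm
    obtain ⟨α, hα⟩ := notMem_map_C_iff.1 hf
    exact ⟨⟨f, hfq⟩, coeff α f, hα, fun m' _ hm' => notMem_map_C_iff.2 ⟨α, hm'⟩⟩

theorem quotient (h : DivisiblePrufer D y) (P : Ideal D) :
    DivisiblePrufer (D ⧸ P) (Ideal.Quotient.mk P y) := by
  have hmax : ∀ m : Ideal (D ⧸ P), m.IsMaximal → (m.comap (Ideal.Quotient.mk P)).IsMaximal :=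
    fun m hm => Ideal.comap_isMaximal_of_surjective _ Ideal.Quotient.mk_surjective
  constructor
  · intro m hm a b
    obtain ⟨a, rfl⟩ := Ideal.Quotient.mk_surjective a
    obtain ⟨b, rfl⟩ := Ideal.Quotient.mk_surjective b
    obtain ⟨s, hs, hd⟩ := h.total _ (hmax m hm) a b
    refine ⟨Ideal.Quotient.mk P s, hs, ?_⟩
    rw [← map_mul, ← map_mul]
    exact hd.imp (map_dvd _) (map_dvd _)
  · exact fun m hm => h.mem _ (hmax m hm)
  · intro m hm a ha
    obtain ⟨a, rfl⟩ := Ideal.Quotient.mk_surjective a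
    obtain ⟨s, hs, hd⟩ := h.unif _ (hmax m hm) a ha
    exact ⟨Ideal.Quotient.mk P s, hs, by rw [← map_mul]; exact map_dvd _ hd⟩
  · intro m hm a ha n hn
    obtain ⟨a, rfl⟩ := Ideal.Quotient.mk_surjective a
    obtain ⟨s, hs, t, ht, j, b, e⟩ := h.root _ (hmax m hm) a (fun H => ha (by simp [H])) n hn
    exact ⟨Ideal.Quotient.mk P s, hs, Ideal.Quotient.mk P t, ht, j, Ideal.Quotient.mk P b, by
      simpa using congrArg (Ideal.Quotient.mk P) e⟩

end MvPolynomial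

end DivisiblePrufer

theorem MvPolynomial.isIntegrallyClosed_fin {D : Type*} [CommRing D] [IsDomain D]
    [IsIntegrallyClosed D] (d : ℕ) : IsIntegrallyClosed (MvPolynomial (Fin d) D) := by
  induction d with
  | zero => exact IsIntegrallyClosed.of_equiv (MvPolynomial.isEmptyRingEquiv D (Fin 0)).symm
  | succ d ih => exact IsIntegrallyClosed.of_equiv (MvPolynomial.finSuccEquiv D d).symm.toRingEquiv

namespace MvPolynomial

variable {D : Type*} [CommRing D] {d r : ℕ}

/-- The position-over-term order on the monomials of a free module over a polynomial ring. -/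
def position (i : Fin r) (α : Fin d →₀ ℕ) : Fin r ×ₗ Lex (Fin d →₀ ℕ) := toLex (i, toLex α)

theorem position_add_lt_position_add {i j : Fin r} {α β : Fin d →₀ ℕ} (γ : Fin d →₀ ℕ) :
    position i (α + γ) < position j (β + γ) ↔ position i α < position j β := by
  simp [position, Prod.Lex.toLex_lt_toLex, toLex_add]

/-- The position `(i, α)` is the leading position of `x` modulo the ideal `m`. -/
def IsLead (m : Ideal D) (x : Fin r → MvPolynomial (Fin d) D) (i : Fin r) (α : Fin d →₀ ℕ) :
    Prop :=
  coeff α (x i) ∉ m ∧ ∀ j β, position i α < position j β → coeff β (x j) ∈ m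

/-- All components of `x` have total degree at most `k`. -/
def DegreeLE (x : Fin r → MvPolynomial (Fin d) D) (k : ℕ) : Prop :=
  ∀ j β, k < β.degree → coeff β (x j) = 0

theorem exists_isLead {m : Ideal D} {x : Fin r → MvPolynomial (Fin d) D}
    (hx : ∃ i α, coeff α (x i) ∉ m) : ∃ i α, IsLead m x i α := by
  classical
  let P : Finset (Σ _ : Fin r, Fin d →₀ ℕ) :=
    (Finset.univ.sigma fun i => (x i).support).filter fun p => coeff p.2 (x p.1) ∉ m
  have hP : ∀ p, p ∈ P ↔ coeff p.2 (x p.1) ∉ m := by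
    intro p
    simp only [P, Finset.mem_filter, Finset.mem_sigma, Finset.mem_univ, true_and,
      MvPolynomial.mem_support_iff, and_iff_right_iff_imp]
    intro hp h0
    exact hp (h0 ▸ m.zero_mem)
  obtain ⟨i, α, h⟩ := hx
  obtain ⟨p, hp, hmax⟩ := P.exists_max_image (fun p => position p.1 p.2) ⟨⟨i, α⟩, (hP _).2 h⟩
  refine ⟨p.1, p.2, (hP p).1 hp, fun j β hlt => ?_⟩
  by_contra hjb
  exact absurd hlt (not_lt.2 (hmax ⟨j, β⟩ ((hP _).2 hjb)))

theorem IsLead.monomial_smul {m : Ideal D} {x : Fin r → MvPolynomial (Fin d) D} {i : Fin r}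
    {α : Fin d →₀ ℕ} (h : IsLead m x i α) (β : Fin d →₀ ℕ) :
    IsLead m (monomial β (1 : D) • x) i (α + β) := by
  refine ⟨by simpa [coeff_monomial_mul', add_comm α β] using h.1, fun j γ hlt => ?_⟩
  rw [Pi.smul_apply, smul_eq_mul, coeff_monomial_mul', one_mul]
  split_ifs with hle
  · obtain ⟨δ, rfl⟩ := exists_add_of_le hle
    rw [add_comm β δ, position_add_lt_position_add] at hlt
    simpa using h.2 j δ hlt
  · exact m.zero_mem

theorem DegreeLE.monomial_smul {x : Fin r → MvPolynomial (Fin d) D} {k : ℕ} (h : DegreeLE x k)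
    (β : Fin d →₀ ℕ) : DegreeLE (monomial β (1 : D) • x) (k + β.degree) := by
  intro j γ hlt
  rw [Pi.smul_apply, smul_eq_mul, coeff_monomial_mul', one_mul]
  split_ifs with hle
  · obtain ⟨δ, rfl⟩ := exists_add_of_le hle
    refine h j _ ?_
    rw [map_add] at hlt
    simp; lia
  · rfl

theorem DegreeLE.mono {x : Fin r → MvPolynomial (Fin d) D} {k l : ℕ} (h : DegreeLE x k)
    (hkl : k ≤ l) : DegreeLE x l := fun j β hlt => h j β (hkl.trans_lt hlt)

theorem exists_degreeLE (x : Fin r → MvPolynomial (Fin d) D) : ∃ k, DegreeLE x k := by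
  refine ⟨Finset.univ.sup fun i => (x i).totalDegree, fun j β hlt => ?_⟩
  refine coeff_eq_zero_of_totalDegree_lt ?_
  refine (Finset.le_sup (f := fun i => (x i).totalDegree) (Finset.mem_univ j)).trans_lt ?_
  simpa [Finsupp.degree_apply] using hlt

end MvPolynomial

theorem Set.exists_finset_dickson {d : ℕ} (S : Set ((Fin d →₀ ℕ) × ℕ)) :
    ∃ Γ : Finset ((Fin d →₀ ℕ) × ℕ), (Γ : Set _) ⊆ S ∧ ∀ a ∈ S, ∃ γ ∈ Γ, γ ≤ a := by
  have hfin : {a | Minimal (· ∈ S) a}.Finite :=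
    WellQuasiOrderedLE.finite_of_isAntichain (setOfPred_minimal_antichain _)
  refine ⟨hfin.toFinset, fun a ha => ?_, fun a ha => ?_⟩
  · exact (by simpa using ha : Minimal (· ∈ S) a).prop
  · obtain ⟨b, hba, hb⟩ := exists_minimal_le_of_wellFoundedLT (· ∈ S) a ha
    exact ⟨b, by simpa using hb, hba⟩

namespace DivisiblePrufer

variable {D : Type*} [CommRing D] {y : D} {d r : ℕ}

theorem isLead_eventually (h : DivisiblePrufer D y) {m : Ideal D} (hm : m.IsMaximal)
    {x : Fin r → MvPolynomial (Fin d) D} {i : Fin r} {α : Fin d →₀ ℕ} (hx : IsLead m x i α) :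
    ∃ s ∉ m, ∀ m' : Ideal D, m'.IsMaximal → s ∉ m' → IsLead m' x i α := by
  classical
  let P : Finset (Σ _ : Fin r, Fin d →₀ ℕ) :=
    (Finset.univ.sigma fun i => (x i).support).filter fun p => position i α < position p.1 p.2
  have hP : ∀ p, ∃ s ∉ m, p ∈ P → y ∣ s * coeff p.2 (x p.1) := by
    intro p
    by_cases hp : p ∈ P
    · obtain ⟨s, hs, hd⟩ := h.unif m hm _ (hx.2 p.1 p.2 (Finset.mem_filter.1 hp).2)
      exact ⟨s, hs, fun _ => hd⟩
    · exact ⟨1, (Ideal.ne_top_iff_one m).1 hm.ne_top, fun hp' => absurd hp' hp⟩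
  choose s hs hsd using hP
  refine ⟨coeff α (x i) * ∏ p ∈ P, s p, fun H => ?_, fun m' hm' hns => ?_⟩
  · rcases hm.isPrime.mem_or_mem H with H | H
    · exact hx.1 H
    · obtain ⟨p, _, hp⟩ := hm.isPrime.prod_mem_iff.1 H
      exact hs p hp
  · refine ⟨fun H => hns (m'.mul_mem_right _ H), fun j β hlt => ?_⟩
    by_cases h0 : coeff β (x j) = 0
    · rw [h0]; exact m'.zero_mem
    have hp : (⟨j, β⟩ : Σ _ : Fin r, Fin d →₀ ℕ) ∈ P := by simp [P, h0, hlt]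
    refine (hm'.isPrime.mem_or_mem (m'.mem_of_dvd (hsd _ hp) (h.mem m' hm'))).resolve_left ?_
    exact fun H => hns (m'.mul_mem_left _ (m'.mem_of_dvd (Finset.dvd_prod_of_mem s hp) H))

variable [IsDomain D]

theorem eq_zero_of_coeff_eq_zero (h : DivisiblePrufer D y) {m : Ideal D} (hm : m.IsMaximal)
    {N : Submodule (MvPolynomial (Fin d) D) (Fin r → MvPolynomial (Fin d) D)}
    (hN : ∀ c : D, c ≠ 0 → ∀ x, (C c : MvPolynomial (Fin d) D) • x ∈ N → x ∈ N) {k : ℕ}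
    {x : Fin r → MvPolynomial (Fin d) D} (hxN : x ∈ N) (hxk : DegreeLE x k)
    (hx : ∀ i α, α.degree ≤ k → (∃ z ∈ N, DegreeLE z k ∧ IsLead m z i α) → coeff α (x i) = 0) :
    x = 0 := by
  by_contra hx0
  obtain ⟨s, hs, c, hc, x', hx', e⟩ := h.exists_content_pi m hm x hx0
  have hcoeff : ∀ j β, s * coeff β (x j) = c * coeff β (x' j) := fun j β => by
    simpa using congrArg (coeff β) (congrFun e j)
  have hs0 : s ≠ 0 := fun H => hs (H ▸ m.zero_mem)
  have hx'N : x' ∈ N := hN c hc x' (e ▸ N.smul_mem _ hxN)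
  have hx'k : DegreeLE x' k := fun j β hlt => by
    have := hcoeff j β
    rw [hxk j β hlt, mul_zero] at this
    exact (mul_eq_zero.1 this.symm).resolve_left hc
  obtain ⟨i, α, hlead⟩ := exists_isLead hx'
  have hα : α.degree ≤ k := by
    by_contra! hlt
    exact hlead.1 (hx'k i α hlt ▸ m.zero_mem)
  have h1 := hcoeff i α
  rw [hx i α hα ⟨x', hx'N, hx'k, hlead⟩, mul_zero] at h1
  exact hlead.1 ((mul_eq_zero.1 h1.symm).resolve_left hc ▸ m.zero_mem)

theorem exists_finset_span (h : DivisiblePrufer D y) {m : Ideal D} (hm : m.IsMaximal)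
    {N : Submodule (MvPolynomial (Fin d) D) (Fin r → MvPolynomial (Fin d) D)}
    (hN : ∀ c : D, c ≠ 0 → ∀ x, (C c : MvPolynomial (Fin d) D) • x ∈ N → x ∈ N) :
    ∃ s ∉ m, ∃ G : Finset (Fin r → MvPolynomial (Fin d) D),
      (G : Set (Fin r → MvPolynomial (Fin d) D)) ⊆ N ∧
      ∀ m' : Ideal D, m'.IsMaximal → s ∉ m' → ∀ x ∈ N, ∃ t ∉ m',
        (C t : MvPolynomial (Fin d) D) • x ∈
          Submodule.span (MvPolynomial (Fin d) D) (G : Set _) := by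
  classical
  let S : Fin r → Set ((Fin d →₀ ℕ) × ℕ) := fun i =>
    {a | ∃ z ∈ N, DegreeLE z (a.1.degree + a.2) ∧ IsLead m z i a.1}
  choose Γ hΓS hΓ using fun i => (S i).exists_finset_dickson
  have hw : ∀ (i : Fin r) (a : Γ i), ∃ z ∈ N, DegreeLE z (a.1.1.degree + a.1.2) ∧
      ∃ s ∉ m, ∀ m' : Ideal D, m'.IsMaximal → s ∉ m' → IsLead m' z i a.1.1 := by
    intro i a
    obtain ⟨z, hzN, hzk, hz⟩ := hΓS i a.2
    exact ⟨z, hzN, hzk, h.isLead_eventually hm hz⟩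
  choose z hzN hzk s hs hz using hw
  refine ⟨∏ p : Σ i, Γ i, s p.1 p.2, fun H => ?_, Finset.univ.image fun p : Σ i, Γ i => z p.1 p.2,
    fun x hx => ?_, fun m' hm' hns x hxN => ?_⟩
  · obtain ⟨p, _, hp⟩ := hm.isPrime.prod_mem_iff.1 H
    exact hs _ _ hp
  · obtain ⟨p, _, rfl⟩ := Finset.mem_image.1 (Finset.mem_coe.1 hx)
    exact hzN _ _
  have hz' : ∀ i a, IsLead m' (z i a) i a.1.1 := fun i a => hz i a m' hm' fun H => hns <|
    m'.mem_of_dvd (Finset.dvd_prod_of_mem (fun p : Σ i, Γ i => s p.1 p.2)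
      (Finset.mem_univ ⟨i, a⟩)) H
  obtain ⟨k, hk⟩ := exists_degreeLE x
  -- the leading positions modulo `m` of the elements of `N` of degree at most `k`
  have hfin : {p : Fin r × (Fin d →₀ ℕ) | p.2.degree ≤ k ∧
      ∃ w ∈ N, DegreeLE w k ∧ IsLead m w p.1 p.2}.Finite := by
    refine Set.Finite.subset ((Set.finite_univ (α := Fin r)).prod
      (Finsupp.finite_of_degree_le (σ := Fin d) k)) fun p hp => ?_
    exact ⟨Set.mem_univ _, hp.1⟩
  let U := hfin.toFinset
  have hU : ∀ p : U, ∃ g ∈ Submodule.span (MvPolynomial (Fin d) D)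
      ((Finset.univ.image fun p : Σ i, Γ i => z p.1 p.2 : Finset _) : Set _),
      g ∈ N ∧ DegreeLE g k ∧ IsLead m' g p.1.1 p.1.2 := by
    rintro ⟨⟨i, α⟩, hp⟩
    obtain ⟨hα, w, hwN, hwk, hw⟩ := hfin.mem_toFinset.1 hp
    simp only at hα hw
    obtain ⟨γ, hγ, hle⟩ := hΓ i (α, k - α.degree)
      ⟨w, hwN, hwk.mono (by simp only; lia), hw⟩
    obtain ⟨β, hβ⟩ := exists_add_of_le hle.1
    simp only at hβ
    have hle2 : γ.2 ≤ k - α.degree := hle.2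
    refine ⟨monomial β (1 : D) • z i ⟨γ, hγ⟩, Submodule.smul_mem _ _ (Submodule.subset_span ?_),
      N.smul_mem _ (hzN _ _), ((hzk i ⟨γ, hγ⟩).monomial_smul β).mono ?_, ?_⟩
    · exact Finset.mem_coe.2 (Finset.mem_image.2 ⟨⟨i, γ, hγ⟩, Finset.mem_univ _, rfl⟩)
    · have := congrArg Finsupp.degree hβ
      rw [map_add] at this
      simp only
      lia
    · simp only [hβ]
      exact (hz' i ⟨γ, hγ⟩).monomial_smul β
  choose g hgG hgN hgk hg using hU
  let A : Matrix U U D := fun p q => coeff q.1.2 (g p q.1.1)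
  have hdet : A.det ∉ m' := by
    intro H
    rw [← Ideal.Quotient.eq_zero_iff_mem, RingHom.map_det] at H
    let _ : LinearOrder U := LinearOrder.lift' (fun p : U => position p.1.1 p.1.2)
      (fun p q hpq => by
        have h1 : (p.1.1, toLex p.1.2) = (q.1.1, toLex q.1.2) := toLex.injective hpq
        rw [Prod.mk.injEq] at h1
        exact Subtype.ext (Prod.ext h1.1 (toLex.injective h1.2)))
    rw [← Matrix.det_transpose, Matrix.det_of_isUpperTriangular] at H
    · have := hm'.isPrime
      obtain ⟨p, _, hp⟩ := Finset.prod_eq_zero_iff.1 H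
      exact (hg p).1 (Ideal.Quotient.eq_zero_iff_mem.1 hp)
    · intro p q hlt
      exact Ideal.Quotient.eq_zero_iff_mem.2 ((hg q).2 _ _ hlt)
  refine ⟨A.det, hdet, ?_⟩
  let c : U → D := Matrix.vecMul (fun q : U => coeff q.1.2 (x q.1.1)) A.adjugate
  have hc : ∀ q : U, ∑ p, c p * coeff q.1.2 (g p q.1.1) = A.det * coeff q.1.2 (x q.1.1) := by
    intro q
    have : Matrix.vecMul c A = A.det • fun q : U => coeff q.1.2 (x q.1.1) := by
      rw [Matrix.vecMul_vecMul, Matrix.adjugate_mul, Matrix.vecMul_smul, Matrix.vecMul_one]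
    exact congrFun this q
  have hcomb : (C A.det : MvPolynomial (Fin d) D) • x -
      ∑ p, (C (c p) : MvPolynomial (Fin d) D) • g p = 0 := by
    have hco : ∀ i α, coeff α (((C A.det : MvPolynomial (Fin d) D) • x -
        ∑ p, (C (c p) : MvPolynomial (Fin d) D) • g p) i) =
          A.det * coeff α (x i) - ∑ p, c p * coeff α (g p i) := by
      intro i α
      simp [Finset.sum_apply, MvPolynomial.coeff_sum]
    refine h.eq_zero_of_coeff_eq_zero hm hN (k := k) ?_ ?_ ?_
    · exact N.sub_mem (N.smul_mem _ hxN) (N.sum_mem fun p _ => N.smul_mem _ (hgN p))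
    · intro j β hlt
      rw [hco, hk j β hlt, Finset.sum_eq_zero fun p _ => by rw [hgk p j β hlt, mul_zero]]
      simp
    · intro i α hα hex
      rw [hco]
      exact sub_eq_zero.2 (hc ⟨(i, α), hfin.mem_toFinset.2 ⟨hα, hex⟩⟩).symm
  rw [sub_eq_zero.1 hcomb]
  exact Submodule.sum_mem _ fun p _ => Submodule.smul_mem _ _ (hgG p)

/-- A submodule of a finite free module over `D[z]` which is saturated with respect to the nonzero
constants is finitely generated. -/
theorem fg_of_saturated (h : DivisiblePrufer D y)
    {N : Submodule (MvPolynomial (Fin d) D) (Fin r → MvPolynomial (Fin d) D)}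
    (hN : ∀ c : D, c ≠ 0 → ∀ x, (C c : MvPolynomial (Fin d) D) • x ∈ N → x ∈ N) : N.FG := by
  classical
  let T : Set D := {s | ∃ G : Finset (Fin r → MvPolynomial (Fin d) D),
    (G : Set (Fin r → MvPolynomial (Fin d) D)) ⊆ N ∧
      ∀ m' : Ideal D, m'.IsMaximal → s ∉ m' → ∀ x ∈ N, ∃ t ∉ m',
        (C t : MvPolynomial (Fin d) D) • x ∈
          Submodule.span (MvPolynomial (Fin d) D) (G : Set _)}
  have hT : (1 : D) ∈ Ideal.span T := by
    rw [← Ideal.eq_top_iff_one]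
    refine Ideal.eq_top_of_forall_isMaximal _ fun m hm => ?_
    obtain ⟨s, hs, hG⟩ := h.exists_finset_span hm hN
    exact ⟨s, hs, Ideal.subset_span hG⟩
  obtain ⟨F, hFT, hF⟩ := Submodule.mem_span_finite_of_mem_span hT
  choose G hGN hG using fun s : F => hFT s.2
  refine ⟨Finset.univ.biUnion G, le_antisymm (Submodule.span_le.2 fun x hx => ?_) fun x hx => ?_⟩
  · obtain ⟨s, _, hs⟩ := Finset.mem_biUnion.1 (Finset.mem_coe.1 hx)
    exact hGN s hs
  · refine Submodule.mem_of_forall_isMaximal ((Submodule.span (MvPolynomial (Fin d) D)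
      (Finset.univ.biUnion G : Set _)).restrictScalars D) x fun m hm => ?_
    obtain ⟨s, hsF, hs⟩ : ∃ s ∈ F, s ∉ m := by
      by_contra! hcon
      exact hm.ne_top ((Ideal.eq_top_iff_one m).2 (Ideal.span_le.2 hcon hF))
    obtain ⟨t, ht, hx⟩ := hG ⟨s, hsF⟩ m hm hs x hx
    refine ⟨t, ht, ?_⟩
    have : t • x = (C t : MvPolynomial (Fin d) D) • x := by
      ext1 i; simp [MvPolynomial.smul_eq_C_mul]
    rw [Submodule.restrictScalars_mem, this]
    exact Submodule.span_mono (Finset.coe_subset.2 (Finset.subset_biUnion_of_mem G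
      (Finset.mem_univ _))) hx

end DivisiblePrufer

section Kaplansky

variable {B L : Type*} [CommRing B] [Field L] [Algebra B L] [IsIntegrallyClosedIn B L]

theorem exists_smul_eq_of_aeval_eq_zero (Q : Ideal B) [Q.IsPrime] (x : L) (f : Polynomial B)
    (hf : Polynomial.aeval x f = 0) (hn : ∃ n, f.coeff n ∉ Q) :
    ∃ a b : B, algebraMap B L a * x = algebraMap B L b ∧ (a ∉ Q ∨ b ∉ Q) := by
  obtain ⟨n, hn⟩ := hn
  induction hm : f.natDegree using Nat.strong_induction_on generalizing f n with | h m IH =>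
  obtain _ | m := m
  · obtain ⟨c, rfl⟩ := Polynomial.natDegree_eq_zero.mp hm
    rw [Polynomial.aeval_C] at hf
    have hc : c = 0 := (map_eq_zero_iff _ (IsIntegralClosure.algebraMap_injective B B L)).1 hf
    exact absurd (by simp [hc]) hn
  obtain ⟨a, ha⟩ := IsIntegrallyClosedIn.isIntegral_iff.1 (isIntegral_leadingCoeff_smul f x hf)
  rw [Algebra.smul_def] at ha
  by_cases hlc : f.leadingCoeff ∈ Q
  · by_cases haQ : a ∈ Q
    · refine IH _ ?_ (f.eraseLead + Polynomial.C a * Polynomial.X ^ m) ?_ n ?_ rfl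
      · suffices (f.eraseLead + Polynomial.C a * Polynomial.X ^ m).natDegree ≤ m by lia
        refine Polynomial.natDegree_add_le_of_degree_le ?_ (Polynomial.natDegree_C_mul_X_pow_le _ _)
        exact (Polynomial.eraseLead_natDegree_le ..).trans (by lia)
      · rw [← Polynomial.self_sub_monomial_natDegree_leadingCoeff, map_add, map_sub, hf, hm,
          Polynomial.aeval_monomial, map_mul, Polynomial.aeval_C, map_pow, Polynomial.aeval_X, ha]
        ring
      · rw [Polynomial.coeff_add, Polynomial.eraseLead_coeff,
          if_neg (by rintro rfl; exact hn hlc), Polynomial.coeff_C_mul, Ideal.add_mem_iff_left]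
        · exact hn
        · exact Q.mul_mem_right _ haQ
    · exact ⟨_, a, ha.symm, Or.inr haQ⟩
  · exact ⟨_, a, ha.symm, Or.inl hlc⟩

/-- The localization of `B` at a prime `Q`, inside `L`, as a valuation subring. -/
def ValuationSubring.ofPrimitive (Q : Ideal B) [hQ : Q.IsPrime]
    (hL : ∀ x : L, ∃ f : Polynomial B, Polynomial.aeval x f = 0 ∧ ∃ n, f.coeff n ∉ Q) :
    ValuationSubring L where
  carrier := {x | ∃ s ∉ Q, ∃ b : B, algebraMap B L s * x = algebraMap B L b}
  mul_mem' := by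
    rintro x x' ⟨s, hs, b, hb⟩ ⟨s', hs', b', hb'⟩
    refine ⟨s * s', fun H => (hQ.mem_or_mem H).elim hs hs', b * b', ?_⟩
    rw [map_mul, map_mul, ← hb, ← hb']; ring
  one_mem' := ⟨1, (Ideal.ne_top_iff_one Q).1 hQ.ne_top, 1, by simp⟩
  add_mem' := by
    rintro x x' ⟨s, hs, b, hb⟩ ⟨s', hs', b', hb'⟩
    refine ⟨s * s', fun H => (hQ.mem_or_mem H).elim hs hs', b * s' + s * b', ?_⟩
    simp only [map_mul, map_add, ← hb, ← hb']; ring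
  zero_mem' := ⟨1, (Ideal.ne_top_iff_one Q).1 hQ.ne_top, 0, by simp⟩
  neg_mem' := by
    rintro x ⟨s, hs, b, hb⟩
    exact ⟨s, hs, -b, by simp [hb]⟩
  mem_or_inv_mem' := by
    intro x
    obtain ⟨f, hf, hn⟩ := hL x
    obtain ⟨a, b, hab, ha | hb⟩ := exists_smul_eq_of_aeval_eq_zero Q x f hf hn
    · exact Or.inl ⟨a, ha, b, hab⟩
    · refine Or.inr ?_
      by_cases hx : x = 0
      · exact ⟨1, (Ideal.ne_top_iff_one Q).1 hQ.ne_top, 0, by simp [hx]⟩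
      · exact ⟨b, hb, a, by rw [← hab]; field_simp⟩

end Kaplansky

theorem Valuation.exists_eq_of_sum_eq_zero {K Γ₀ : Type*} [Field K]
    [LinearOrderedCommGroupWithZero Γ₀] (v : Valuation K Γ₀) {n : ℕ} (f : ℕ → K)
    (hsum : ∑ i ∈ Finset.range n, f i = 0) (hf : ∃ i < n, f i ≠ 0) :
    ∃ i j, i < j ∧ j < n ∧ f i ≠ 0 ∧ v (f i) = v (f j) := by
  obtain ⟨k, hk, hk0⟩ := hf
  obtain ⟨i, hi, hmax⟩ := (Finset.range n).exists_max_image (fun i => v (f i))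
    ⟨k, Finset.mem_range.2 hk⟩
  have hi0 : v (f i) ≠ 0 := by
    intro h0
    have := hmax k (Finset.mem_range.2 hk)
    rw [h0, le_zero_iff, v.zero_iff] at this
    exact hk0 this
  have : ∃ j ∈ Finset.range n, j ≠ i ∧ v (f j) = v (f i) := by
    by_contra! hcon
    have hlt : ∀ j ∈ Finset.range n \ {i}, v (f j) < v (f i) := fun j hj => by
      simp only [Finset.mem_sdiff, Finset.mem_singleton] at hj
      exact lt_of_le_of_ne (hmax j hj.1) (hcon j hj.1 hj.2)
    have := v.map_sum_eq_of_lt hi hlt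
    rw [hsum, map_zero] at this
    exact hi0 this.symm
  obtain ⟨j, hj, hji, e⟩ := this
  rcases lt_or_gt_of_ne hji with hlt | hlt
  · exact ⟨j, i, hlt, Finset.mem_range.1 hi, fun h0 => hi0 (by rw [← e, h0, map_zero]), e⟩
  · exact ⟨i, j, hlt, Finset.mem_range.1 hj, fun h0 => hi0 (by rw [h0, map_zero]), e.symm⟩

section ValuationOfPrimitive

variable {B L : Type*} [CommRing B] [Field L] [Algebra B L] [IsIntegrallyClosedIn B L]
  (Q : Ideal B) [hQ : Q.IsPrime]
  (hL : ∀ x : L, ∃ f : Polynomial B, Polynomial.aeval x f = 0 ∧ ∃ n, f.coeff n ∉ Q)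

theorem ValuationSubring.mem_ofPrimitive {x : L} : x ∈ ofPrimitive Q hL ↔
    ∃ s ∉ Q, ∃ b : B, algebraMap B L s * x = algebraMap B L b := Iff.rfl

theorem ValuationSubring.valuation_ofPrimitive_eq_one {b : B} (hb : b ∉ Q) :
    (ofPrimitive Q hL).valuation (algebraMap B L b) = 1 := by
  have hb0 : algebraMap B L b ≠ 0 := fun H => hb <| by
    rw [(map_eq_zero_iff _ (IsIntegralClosure.algebraMap_injective B B L)).1 H]; exact Q.zero_mem
  refine le_antisymm ((valuation_le_one_iff _ _).2 ((mem_ofPrimitive Q hL).2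
    ⟨1, (Ideal.ne_top_iff_one Q).1 hQ.ne_top, b, by simp⟩)) ?_
  have : (ofPrimitive Q hL).valuation (algebraMap B L b)⁻¹ ≤ 1 := by
    refine (valuation_le_one_iff _ _).2 ((mem_ofPrimitive Q hL).2 ⟨b, hb, 1, ?_⟩)
    rw [mul_inv_cancel₀ hb0, map_one]
  rwa [map_inv₀, inv_le_one₀ (by simpa [zero_lt_iff] using hb0)] at this

theorem ValuationSubring.valuation_ofPrimitive_lt_one {b : B} (hb : b ∈ Q) :
    (ofPrimitive Q hL).valuation (algebraMap B L b) < 1 := by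
  by_contra! hle
  have hb0 : algebraMap B L b ≠ 0 := fun H => by rw [H, map_zero] at hle; simp at hle
  rw [← inv_le_one₀ (by simpa [zero_lt_iff] using hb0), ← map_inv₀, valuation_le_one_iff] at hle
  obtain ⟨s, hs, c, hc⟩ := (mem_ofPrimitive Q hL).1 hle
  refine hs ?_
  have : algebraMap B L s = algebraMap B L (b * c) := by
    rw [map_mul, ← hc]; field_simp
  have h0 : s - b * c = 0 :=
    (map_eq_zero_iff _ (IsIntegralClosure.algebraMap_injective B B L)).1
      (by rw [map_sub, this, sub_self])
  rw [sub_eq_zero.1 h0]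
  exact Q.mul_mem_right _ hb

end ValuationOfPrimitive

namespace DivisiblePrufer

section Inertia

variable {D : Type*} [CommRing D] [IsDomain D] {y : D} {d : ℕ}
  {F L : Type*} [Field F] [Field L] [Algebra (MvPolynomial (Fin d) D) F]
  [IsFractionRing (MvPolynomial (Fin d) D) F] [Algebra F L] [Algebra (MvPolynomial (Fin d) D) L]
  [IsScalarTower (MvPolynomial (Fin d) D) F L]

theorem exists_primitive_relation (h : DivisiblePrufer D y) {m : Ideal D} (hm : m.IsMaximal)
    {x : L} {p : Polynomial F} (hp0 : p ≠ 0) (hp : Polynomial.aeval x p = 0) {n : ℕ}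
    (hn : p.natDegree ≤ n) :
    ∃ c : Fin (n + 1) → MvPolynomial (Fin d) D,
      (∃ i, c i ∉ m.map (C : D →+* MvPolynomial (Fin d) D)) ∧
        ∑ i, algebraMap _ L (c i) * x ^ (i : ℕ) = 0 := by
  let q := IsLocalization.integerNormalization (nonZeroDivisors (MvPolynomial (Fin d) D)) p
  have hq0 : q ≠ 0 := fun H => hp0 (IsFractionRing.integerNormalization_eq_zero_iff.1 H)
  have hq : Polynomial.aeval x q = 0 :=
    IsLocalization.integerNormalization_aeval_eq_zero _ p hp
  have hqn : q.natDegree < n + 1 := by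
    refine Nat.lt_succ_of_le (le_trans ?_ hn)
    refine Polynomial.natDegree_le_iff_coeff_eq_zero.2 fun N hN => ?_
    refine Polynomial.notMem_support_iff.1 fun H => ?_
    exact Polynomial.mem_support_iff.1 (IsLocalization.integerNormalization_support _ p H)
      (Polynomial.coeff_eq_zero_of_natDegree_lt hN)
  have hx0 : (fun i : Fin (n + 1) => q.coeff i) ≠ 0 := by
    intro H
    have := congrFun H ⟨q.natDegree, hqn⟩
    exact hq0 (Polynomial.leadingCoeff_eq_zero.1 this)
  obtain ⟨s, hs, c, hc, x', ⟨i, α, hx'⟩, e⟩ := h.exists_content_pi m hm _ hx0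
  refine ⟨x', ⟨i, notMem_map_C_iff.2 ⟨α, hx'⟩⟩, ?_⟩
  have hinj : Function.Injective (algebraMap (MvPolynomial (Fin d) D) L) := by
    rw [IsScalarTower.algebraMap_eq _ F L]
    exact (algebraMap F L).injective.comp (IsFractionRing.injective _ F)
  have hc' : algebraMap (MvPolynomial (Fin d) D) L (C c) ≠ 0 := by
    rw [Ne, map_eq_zero_iff _ hinj]; simpa using hc
  refine (mul_eq_zero.1 ?_).resolve_left hc'
  rw [Polynomial.aeval_eq_sum_range' hqn, Finset.sum_range] at hq
  calc _ = algebraMap (MvPolynomial (Fin d) D) L (C s) *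
        ∑ i : Fin (n + 1), q.coeff i • x ^ (i : ℕ) := by
        rw [Finset.mul_sum, Finset.mul_sum]
        refine Finset.sum_congr rfl fun j _ => ?_
        have := congrArg (algebraMap (MvPolynomial (Fin d) D) L) (congrFun e j)
        simp only [Pi.smul_apply, smul_eq_mul, map_mul] at this
        rw [Algebra.smul_def, ← mul_assoc, ← mul_assoc, this]
    _ = 0 := by rw [hq, mul_zero]

theorem exists_valuation_eq_pow (h : DivisiblePrufer D y) {m : Ideal D} (hm : m.IsMaximal)
    {Γ₀ : Type*} [LinearOrderedCommGroupWithZero Γ₀] (v : Valuation L Γ₀)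
    (hv : ∀ f : MvPolynomial (Fin d) D, f ∉ m.map (C : D →+* MvPolynomial (Fin d) D) →
      v (algebraMap _ L f) = 1)
    {l : ℕ} (hl : 0 < l) {e : L} (he : e ^ l = algebraMap _ L (C y : MvPolynomial (Fin d) D))
    {f : MvPolynomial (Fin d) D} (hf : f ≠ 0) :
    ∃ (k : ℕ) (b : D), v (algebraMap _ L f) =
      v (e ^ k * algebraMap _ L (C b : MvPolynomial (Fin d) D)) ^ l := by
  have hvC : ∀ s ∉ m, v (algebraMap _ L (C s : MvPolynomial (Fin d) D)) = 1 := fun s hs =>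
    hv _ (notMem_map_C_iff.2 ⟨0, by simpa using hs⟩)
  obtain ⟨s, hs, c, hc, g, hg, e1⟩ := h.exists_content m hm f hf
  obtain ⟨s', hs', t, ht, k, b, e2⟩ := h.root m hm c hc l hl
  refine ⟨k, b, ?_⟩
  have e1' := congrArg (fun z => v (algebraMap _ L z)) e1
  have e2' := congrArg (fun z => v (algebraMap (MvPolynomial (Fin d) D) L (C z))) e2
  simp only [map_mul, map_pow, hvC s hs, hvC s' hs', hvC t ht, one_mul,
    hv g (notMem_map_C_iff.2 hg), mul_one] at e1' e2'
  rw [e1', e2', ← he]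
  simp only [map_mul, map_pow, mul_pow, ← pow_mul]
  rw [mul_comm l k]

/-- If `L` is generated over the subfield `E` fixed by `σ` by elements of small degree, and `E`
contains enough roots of `y`, then `σ` is not in the inertia group of any prime over `m D[z]`. -/
theorem exists_mem_span_sub (h : DivisiblePrufer D y) [Algebra ℚ D] [FiniteDimensional F L]
    {m : Ideal D} (hm : m.IsMaximal) (E L₀ : IntermediateField F L) {n : ℕ}
    (hdeg : ∀ x ∈ L₀, (minpoly F x).natDegree ≤ n)
    (hL₀ : ∀ (τ : L ≃ₐ[F] L), ∀ x ∈ L₀, τ x ∈ L₀)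
    (hE : ∀ l, 0 < l → l ≤ n → ∃ e ∈ E, e ^ l = algebraMap _ L (C y : MvPolynomial (Fin d) D))
    (σ : L ≃ₐ[F] L) (hσE : ∀ e ∈ E, σ e = e) (hσ : ∃ x ∈ L₀, σ x ≠ x) :
    ∃ f ∉ m.map (C : D →+* MvPolynomial (Fin d) D),
      algebraMap _ (integralClosure (MvPolynomial (Fin d) D) L) f ∈
        Ideal.span {z : integralClosure (MvPolynomial (Fin d) D) L |
          ∃ b : integralClosure (MvPolynomial (Fin d) D) L, (z : L) = b - σ b} := by
  by_contra! hcon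
  have hP := MvPolynomial.isPrime_map_C (σ := Fin d) m (hm := hm.isPrime)
  obtain ⟨Q, hJQ, hQ, hQP⟩ := Ideal.exists_ideal_over_prime_of_isIntegral
    (m.map (C : D →+* MvPolynomial (Fin d) D))
    (Ideal.span {z : integralClosure (MvPolynomial (Fin d) D) L |
          ∃ b : integralClosure (MvPolynomial (Fin d) D) L, (z : L) = b - σ b})
    (fun f hf => by by_contra hfP; exact hcon f hfP hf)
  have hL : ∀ x : L, ∃ f : Polynomial (integralClosure (MvPolynomial (Fin d) D) L),
      Polynomial.aeval x f = 0 ∧ ∃ n, f.coeff n ∉ Q := by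
    intro x
    obtain ⟨c, ⟨i, hi⟩, hsum⟩ := h.exists_primitive_relation (d := d) hm
      (minpoly.ne_zero (Algebra.IsIntegral.isIntegral (R := F) x)) (minpoly.aeval F x) le_rfl
    refine ⟨∑ j : Fin ((minpoly F x).natDegree + 1),
      Polynomial.monomial (j : ℕ) (algebraMap _ _ (c j)), ?_, i, ?_⟩
    · rw [map_sum, ← hsum]
      refine Finset.sum_congr rfl fun j _ => ?_
      rw [Polynomial.aeval_monomial, ← IsScalarTower.algebraMap_apply]
    · rw [Polynomial.finsetSum_coeff, Finset.sum_eq_single i]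
      · rw [Polynomial.coeff_monomial_same]
        intro H
        exact hi (hQP ▸ H)
      · intro j _ hji
        rw [Polynomial.coeff_monomial_of_ne]
        exact fun H => hji (Fin.ext H.symm)
      · simp
  set v := (ValuationSubring.ofPrimitive Q hL).valuation with hvdef
  have hv : ∀ f : MvPolynomial (Fin d) D, f ∉ m.map (C : D →+* MvPolynomial (Fin d) D) →
      v (algebraMap _ L f) = 1 := fun f hf => by
    rw [IsScalarTower.algebraMap_apply _ (integralClosure (MvPolynomial (Fin d) D) L) L]
    exact ValuationSubring.valuation_ofPrimitive_eq_one Q hL fun H => hf (hQP ▸ H)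
  -- every value on `L₀` is a value on `E`
  have hval : ∀ x ∈ L₀, x ≠ 0 → ∃ c ∈ E, v x = v c := by
    intro x hx hx0
    obtain ⟨c, ⟨i, hi⟩, hsum⟩ := h.exists_primitive_relation (d := d) hm
      (minpoly.ne_zero (Algebra.IsIntegral.isIntegral (R := F) x)) (minpoly.aeval F x) (hdeg x hx)
    have hinj : Function.Injective (algebraMap (MvPolynomial (Fin d) D) L) := by
      rw [IsScalarTower.algebraMap_eq _ F L]
      exact (algebraMap F L).injective.comp (IsFractionRing.injective _ F)
    let c' : ℕ → MvPolynomial (Fin d) D := fun i => if hi : i < n + 1 then c ⟨i, hi⟩ else 0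
    have hc' : ∀ j : Fin (n + 1), c' j = c j := fun j => dif_pos j.2
    have hsum' : ∑ i ∈ Finset.range (n + 1), algebraMap _ L (c' i) * x ^ i = 0 := by
      rw [Finset.sum_range, ← hsum]
      exact Finset.sum_congr rfl fun j _ => by rw [hc']
    obtain ⟨i', j, hij, hjn, hi0, hvij⟩ := v.exists_eq_of_sum_eq_zero _ hsum'
      ⟨i, i.2, mul_ne_zero (by
        rw [Ne, map_eq_zero_iff _ hinj]
        intro H
        exact hi (hc' i ▸ H ▸ Ideal.zero_mem _)) (pow_ne_zero _ hx0)⟩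
    have hj0 : algebraMap _ L (c' j) * x ^ j ≠ 0 := by
      rw [← v.ne_zero_iff, ← hvij, v.ne_zero_iff]; exact hi0
    obtain ⟨e, heE, he⟩ := hE (j - i') (by lia) (by lia)
    have hci : c' i' ≠ 0 := fun H => hi0 (by rw [H, map_zero, zero_mul])
    have hcj : c' j ≠ 0 := fun H => hj0 (by rw [H, map_zero, zero_mul])
    obtain ⟨k₁, b₁, h₁⟩ := h.exists_valuation_eq_pow hm v hv (by lia) he hci
    obtain ⟨k₂, b₂, h₂⟩ := h.exists_valuation_eq_pow hm v hv (by lia) he hcj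
    have hmemE : ∀ (k : ℕ) (b : D), e ^ k * algebraMap _ L (C b : MvPolynomial (Fin d) D) ∈ E := by
      intro k b
      refine E.mul_mem (pow_mem heE k) ?_
      rw [IsScalarTower.algebraMap_apply _ F L]
      exact E.algebraMap_mem _
    refine ⟨_, E.div_mem (hmemE k₁ b₁) (hmemE k₂ b₂), ?_⟩
    rw [map_div₀]
    have hl : j - i' ≠ 0 := by lia
    refine pow_left_injective hl ?_
    beta_reduce
    rw [div_pow, ← h₁, ← h₂, eq_div_iff (by
      rw [v.ne_zero_iff, Ne, map_eq_zero_iff _ hinj]; exact hcj), mul_comm]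
    have hxi : v x ^ i' ≠ 0 := pow_ne_zero _ (v.ne_zero_iff.2 hx0)
    refine mul_right_cancel₀ hxi ?_
    rw [mul_assoc, ← pow_add, Nat.sub_add_cancel hij.le, ← map_pow, ← map_mul, ← hvij, map_mul,
      map_pow]
  have hσb : ∀ b : integralClosure (MvPolynomial (Fin d) D) L,
      IsIntegral (MvPolynomial (Fin d) D) (σ b) := fun b =>
    b.2.map (σ.toAlgHom.restrictScalars (MvPolynomial (Fin d) D))
  have hσQ : ∀ b : integralClosure (MvPolynomial (Fin d) D) L, v (b - σ b) < 1 := by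
    intro b
    have hmem : b - ⟨σ b, hσb b⟩ ∈ Q := hJQ (Ideal.subset_span ⟨b, rfl⟩)
    exact ValuationSubring.valuation_ofPrimitive_lt_one Q hL hmem
  have hσQ' : ∀ (i : ℕ) (b : integralClosure (MvPolynomial (Fin d) D) L),
      v (b - (σ ^ i) b) < 1 := by
    intro i
    induction i with
    | zero => intro b; simp
    | succ i ih =>
      intro b
      have e1 : (b : L) - (σ ^ (i + 1)) b = (b - σ b) + (σ b - (σ ^ i) (σ b)) := by
        rw [pow_succ, AlgEquiv.mul_apply]; ring
      rw [e1]
      exact (v.map_add _ _).trans_lt (max_lt (hσQ b) (ih ⟨σ b, hσb b⟩))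
  have hvle : ∀ b : integralClosure (MvPolynomial (Fin d) D) L, v b ≤ 1 := by
    intro b
    by_cases hb : b ∈ Q
    · exact (ValuationSubring.valuation_ofPrimitive_lt_one Q hL hb).le
    · exact (ValuationSubring.valuation_ofPrimitive_eq_one Q hL hb).le
  have hu : ∀ (i : ℕ) (u : L), v u = 1 → v (u - (σ ^ i) u) < 1 := by
    intro i u hu1
    obtain ⟨s, hs, b, hb⟩ := (ValuationSubring.mem_ofPrimitive Q hL).1
      ((ValuationSubring.valuation_le_one_iff _ u).1 hu1.le)
    have hvs : v (s : L) = 1 := ValuationSubring.valuation_ofPrimitive_eq_one Q hL hs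
    have hvs' : v ((σ ^ i) (s : L)) = 1 := by
      have := v.map_sub_eq_of_lt_left (x := (s : L)) (y := s - (σ ^ i) s) (by
        rw [hvs]; exact hσQ' i s)
      rwa [sub_sub_cancel, hvs] at this
    have hsb : (s : L) * u = b := hb
    have e1 : (s : L) * (σ ^ i) s * (u - (σ ^ i) u) =
        (σ ^ i) s * (b - (σ ^ i) b) - ((σ ^ i) b) * (s - (σ ^ i) s) := by
      rw [← hsb, map_mul]; ring
    have e2 : v (u - (σ ^ i) u) = v ((s : L) * (σ ^ i) s * (u - (σ ^ i) u)) := by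
      rw [map_mul, map_mul, hvs, hvs', one_mul, one_mul]
    have hb1 : v ((σ ^ i) (b : L)) ≤ 1 := by
      have : (σ ^ i) (b : L) = b - (b - (σ ^ i) b) := by ring
      rw [this]
      exact (v.map_sub _ _).trans (max_le (hvle b) (hσQ' i b).le)
    rw [e2, e1]
    refine (v.map_sub _ _).trans_lt (max_lt ?_ ?_)
    · rw [map_mul, hvs', one_mul]; exact hσQ' i b
    · rw [map_mul]
      exact (mul_le_of_le_one_left' hb1).trans_lt (hσQ' i s)
  -- averaging over the powers of `σ`
  obtain ⟨x, hx, hσx⟩ := hσ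
  obtain ⟨p, hp, hσp⟩ : ∃ p, 0 < p ∧ σ ^ p = 1 :=
    isOfFinOrder_iff_pow_eq_one.1 (isOfFinOrder_of_finite σ)
  have hvp : v (p : L) = 1 := by
    have := hv (C (p : D)) (notMem_map_C_iff.2 ⟨0, by
      rw [coeff_C, if_pos rfl]; exact natCast_notMem_of_isMaximal m hm hp.ne'⟩)
    simpa using this
  have hp0 : (p : L) ≠ 0 := fun H => by rw [H, map_zero] at hvp; exact zero_ne_one hvp
  let S : L → L := fun x => ∑ i ∈ Finset.range p, (σ ^ i) x
  have hS : ∀ x, σ (S x) = S x := by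
    intro x
    have e1 : σ (S x) = ∑ i ∈ Finset.range p, (σ ^ (i + 1)) x := by
      simp only [S, map_sum, pow_succ', AlgEquiv.mul_apply]
    have e2 := Finset.sum_range_succ (fun i => (σ ^ i) x) p
    rw [Finset.sum_range_succ', hσp, pow_zero] at e2
    rw [e1]; exact add_right_cancel e2
  have hSfix : ∀ c, σ c = c → ∀ x, S (c * x) = c * S x := by
    intro c hc x
    have hci : ∀ i : ℕ, (σ ^ i) c = c := fun i => by
      induction i with
      | zero => simp
      | succ i ih => rw [pow_succ, AlgEquiv.mul_apply, hc, ih]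
    simp only [S, map_mul, hci, Finset.mul_sum]
  have hS1 : ∀ c, σ c = c → S c = p * c := by
    intro c hc
    have := hSfix c hc 1
    simpa [S, mul_comm] using this
  let z : L := p * x - S x
  have hzL₀ : z ∈ L₀ := by
    refine L₀.sub_mem (L₀.mul_mem (natCast_mem _ p) hx) (L₀.sum_mem fun i _ => hL₀ _ _ hx)
  have hz0 : z ≠ 0 := by
    intro H
    have hpx : (p : L) * x = S x := sub_eq_zero.1 H
    have : (p : L) * σ x = p * x := by
      rw [hpx, ← hS x, ← hpx, map_mul, map_natCast]
    exact hσx (mul_left_cancel₀ hp0 this)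
  have hSz : S z = 0 := by
    have e1 : S z = S (p * x) - S (S x) := by
      simp only [z, S, map_sub, Finset.sum_sub_distrib]
    rw [e1, hSfix _ (by simp), hS1 _ (hS x), sub_self]
  obtain ⟨c, hcE, hvc⟩ := hval z hzL₀ hz0
  have hc0 : c ≠ 0 := by
    rw [← v.ne_zero_iff, ← hvc, v.ne_zero_iff]; exact hz0
  have hvu : v (z / c) = 1 := by rw [map_div₀, hvc, div_self (v.ne_zero_iff.2 hc0)]
  have hSu : S (z / c) = 0 := by
    rw [div_eq_inv_mul, hSfix _ (by rw [map_inv₀, hσE c hcE]), hSz, mul_zero]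
  have e3 : (p : L) * (z / c) = ∑ i ∈ Finset.range p, (z / c - (σ ^ i) (z / c)) := by
    rw [Finset.sum_sub_distrib]
    change _ = _ - S (z / c)
    rw [hSu]; simp
  have : v ((p : L) * (z / c)) < 1 := by
    rw [e3]
    exact v.map_sum_lt one_ne_zero fun i _ => hu i _ hvu
  rw [map_mul, hvp, hvu, one_mul] at this
  exact lt_irrefl _ this

end Inertia

end DivisiblePrufer

section Radical

variable {R E : Type*} [CommRing R] [IsIntegrallyClosed R] [Field E] [Algebra R E]

theorem mem_adjoin_of_mul_mem_adjoin
    (F : Type*) [Field F] [Algebra R F] [IsFractionRing R F] [Algebra F E] [IsScalarTower R F E]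
    {c : R} {N : ℕ} (hN : 0 < N) (hc : ∀ a, c ∣ a ^ N → c ∣ a)
    {π : E} (hπ0 : π ≠ 0) (hπ : π ^ N = algebraMap R E c) {b : E} (hb : IsIntegral R b)
    (hπb : π * b ∈ Algebra.adjoin R {π}) : b ∈ Algebra.adjoin R {π} := by
  have hinj : Function.Injective (algebraMap R E) := by
    rw [IsScalarTower.algebraMap_eq R F E]
    exact (algebraMap F E).injective.comp (IsFractionRing.injective R F)
  have hππ : π ∈ Algebra.adjoin R {π} := Algebra.subset_adjoin rfl
  have hπI : IsIntegral R π := IsIntegral.of_pow hN (hπ ▸ isIntegral_algebraMap)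
  obtain ⟨p, hp⟩ := Algebra.adjoin_singleton_eq_range_aeval R π ▸ hπb
  have hp' : Polynomial.aeval π p = π * b := hp
  have hq : Polynomial.aeval π p.divX ∈ Algebra.adjoin R {π} :=
    Algebra.adjoin_singleton_eq_range_aeval R π ▸ ⟨p.divX, rfl⟩
  set q := Polynomial.aeval π p.divX with hqdef
  have e : algebraMap R E (p.coeff 0) = π * (b - q) := by
    have := congrArg (Polynomial.aeval π) p.divX_mul_X_add
    simp only [map_add, map_mul, Polynomial.aeval_X, Polynomial.aeval_C] at this
    rw [← hqdef, hp'] at this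
    linear_combination this
  have hqI : IsIntegral R q := by
    have : Algebra.adjoin R {π} ≤ integralClosure R E :=
      Algebra.adjoin_le (by simpa [mem_integralClosure_iff] using hπI)
    exact this hq
  have e2 : algebraMap R E (p.coeff 0 ^ N) = algebraMap R E c * (b - q) ^ N := by
    rw [map_pow, e, mul_pow, hπ]
  have hc0 : algebraMap R E c ≠ 0 := hπ ▸ pow_ne_zero N hπ0
  obtain ⟨r, hr⟩ : ∃ r, algebraMap R E r = (b - q) ^ N := by
    have hI : IsIntegral R ((b - q) ^ N) := (hb.sub hqI).pow N
    have e3 : (b - q) ^ N = algebraMap F E (algebraMap R F (p.coeff 0 ^ N) / algebraMap R F c) := by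
      rw [map_div₀, ← IsScalarTower.algebraMap_apply, ← IsScalarTower.algebraMap_apply, e2,
        mul_div_cancel_left₀ _ hc0]
    rw [e3, isIntegral_algebraMap_iff (algebraMap F E).injective] at hI
    obtain ⟨r, hr⟩ := IsIntegrallyClosed.isIntegral_iff.1 hI
    exact ⟨r, by rw [e3, ← hr, ← IsScalarTower.algebraMap_apply]⟩
  obtain ⟨a, ha⟩ := hc _ ⟨r, hinj (by rw [e2, map_mul, hr])⟩
  have e4 : b = q + π ^ (N - 1) * algebraMap R E a := by
    refine mul_left_cancel₀ hπ0 ?_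
    have : π * (b - q) = π ^ N * algebraMap R E a := by rw [← e, ha, map_mul, hπ]
    have h1 : π ^ N = π * π ^ (N - 1) := by rw [← pow_succ', Nat.sub_add_cancel hN]
    rw [h1] at this
    linear_combination this
  rw [e4]
  exact add_mem hq (mul_mem (pow_mem hππ _) (Subalgebra.algebraMap_mem _ _))

variable
  (F : Type*) [Field F] [Algebra R F] [IsFractionRing R F] [Algebra F E] [IsScalarTower R F E]

theorem mem_adjoin_of_isIntegral [IsDomain R] [CharZero F] {c : R} (hc0 : c ≠ 0) {N : ℕ}
    (hN : IsUnit (N : R)) (hN0 : 0 < N) (hc : ∀ a, c ∣ a ^ N → c ∣ a) {π : E} (hπ : π ^ N = algebraMap R E c)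
    (htop : Algebra.adjoin F {π} = ⊤)
    (hmin : minpoly F π = Polynomial.X ^ N - Polynomial.C (algebraMap R F c))
    {b : E} (hb : IsIntegral R b) : b ∈ Algebra.adjoin R {π} := by
  have hinj : Function.Injective (algebraMap R E) := by
    rw [IsScalarTower.algebraMap_eq R F E]
    exact (algebraMap F E).injective.comp (IsFractionRing.injective R F)
  have hπ0 : π ≠ 0 := by
    rintro rfl
    rw [zero_pow hN0.ne'] at hπ
    exact hc0 (hinj (by rw [← hπ, map_zero]))
  have hππ : π ∈ Algebra.adjoin R {π} := Algebra.subset_adjoin rfl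
  have hπI : IsIntegral R π := IsIntegral.of_pow hN0 (hπ ▸ isIntegral_algebraMap)
  have hle : Algebra.adjoin R {π} ≤ integralClosure R E :=
    Algebra.adjoin_le (by simpa [mem_integralClosure_iff] using hπI)
  have : FiniteDimensional F E := by
    have := Algebra.finite_adjoin_of_finite_of_isIntegral (R := F) (Set.finite_singleton π)
      (by simpa using hπI.tower_top)
    rw [htop] at this
    exact Module.Finite.equiv (Subalgebra.topEquiv (R := F) (A := E)).toLinearEquiv
  have key : ∀ k (z : E), IsIntegral R z → π ^ k * z ∈ Algebra.adjoin R {π} →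
      z ∈ Algebra.adjoin R {π} := by
    intro k
    induction k with
    | zero => intro z _ hz; simpa using hz
    | succ k ih =>
      intro z hz hk
      refine ih z hz (mem_adjoin_of_mul_mem_adjoin F hN0 hc hπ0 hπ ((hπI.pow k).mul hz) ?_)
      rwa [← mul_assoc, ← pow_succ']
  refine key (N - 1) b hb ?_
  have hdual : b ∈ (Algebra.traceForm F E).dualSubmodule
      (Subalgebra.toSubmodule (Algebra.adjoin R {π})) := by
    intro x hx
    rw [Submodule.mem_one, Algebra.traceForm_apply]
    exact (IsIntegrallyClosed.isIntegral_iff.1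
      (Algebra.isIntegral_trace (hb.mul (hle hx))))
  rw [traceForm_dualSubmodule_adjoin R F htop hπI, hmin] at hdual
  obtain ⟨w, hw, rfl⟩ := hdual
  obtain ⟨u, hu⟩ := hN
  have hNE : (N : E) ≠ 0 := by
    have := (hinj.ne (u.ne_zero : (u : R) ≠ 0))
    rw [hu] at this
    simpa using this
  have e : π ^ (N - 1) * ((N : E) * π ^ (N - 1))⁻¹ = algebraMap R E (↑u⁻¹ : R) := by
    have h1 : (N : E) * algebraMap R E (↑u⁻¹ : R) = 1 := by
      rw [← map_natCast (algebraMap R E), ← map_mul, ← hu, Units.mul_inv, map_one]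
    rw [mul_inv, mul_left_comm, mul_inv_cancel₀ (pow_ne_zero _ hπ0), mul_one]
    exact inv_eq_of_mul_eq_one_right h1
  have hw' : π ^ (N - 1) * ((N : E) * π ^ (N - 1))⁻¹ * w ∈ Algebra.adjoin R {π} := by
    rw [e]
    exact mul_mem (Subalgebra.algebraMap_mem _ _) hw
  have hder : Polynomial.aeval π (Polynomial.derivative
      (Polynomial.X ^ N - Polynomial.C (algebraMap R F c))) = N * π ^ (N - 1) := by
    simp [Polynomial.derivative_X_pow]
  change π ^ (N - 1) * (_ * w) ∈ _
  rwa [hder, ← mul_assoc]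

end Radical

namespace DivisiblePrufer

variable {D : Type*} [CommRing D] [IsDomain D] {y : D} {d : ℕ}
  {F E : Type*} [Field F] [Field E] [Algebra (MvPolynomial (Fin d) D) F]
  [IsFractionRing (MvPolynomial (Fin d) D) F] [Algebra F E] [Algebra (MvPolynomial (Fin d) D) E]
  [IsScalarTower (MvPolynomial (Fin d) D) F E]

theorem minpoly_root (h : DivisiblePrufer D y) (hy : y ≠ 0) {N : ℕ} (hN : 0 < N) {π : E}
    (hπ : π ^ N = algebraMap (MvPolynomial (Fin d) D) E (C y)) :
    minpoly F π = Polynomial.X ^ N -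
      Polynomial.C (algebraMap (MvPolynomial (Fin d) D) F (C y)) := by
  have := h.isIntegrallyClosed
  have := isIntegrallyClosed_fin (D := D) d
  obtain ⟨m, hm⟩ := Ideal.exists_maximal D
  have hP : (m.map (C : D →+* MvPolynomial (Fin d) D)).IsPrime := MvPolynomial.isPrime_map_C m
  have hy2 : y ∉ m ^ 2 := by
    intro hmem
    have : ∃ s ∉ m, y ^ 2 ∣ s * y := by
      rw [pow_two] at hmem
      refine Submodule.smul_induction_on (p := fun z => ∃ s ∉ m, y ^ 2 ∣ s * z) hmem ?_ ?_
      · intro a ha b hb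
        obtain ⟨s, hs, a', e1⟩ := h.unif m hm a ha
        obtain ⟨t, ht, b', e2⟩ := h.unif m hm b hb
        refine ⟨s * t, fun H => (hm.isPrime.mem_or_mem H).elim hs ht, a' * b', ?_⟩
        rw [smul_eq_mul]
        linear_combination (t * b) * e1 + y * a' * e2
      · rintro a b ⟨s, hs, a', e1⟩ ⟨t, ht, b', e2⟩
        refine ⟨s * t, fun H => (hm.isPrime.mem_or_mem H).elim hs ht, t * a' + s * b', ?_⟩
        linear_combination t * e1 + s * e2
    obtain ⟨s, hs, u, hu⟩ := this
    have : s = y * u := mul_right_cancel₀ hy (by rw [hu]; ring)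
    exact hs (this ▸ m.mul_mem_right _ (h.mem m hm))
  set f : Polynomial (MvPolynomial (Fin d) D) := Polynomial.X ^ N - Polynomial.C (C y) with hf
  have hmonic : f.Monic := Polynomial.monic_X_pow_sub_C _ hN.ne'
  have hdeg : f.natDegree = N := Polynomial.natDegree_X_pow_sub_C
  have hE : f.IsEisensteinAt (m.map C) := by
    refine hmonic.isEisensteinAt_of_mem_of_notMem hP.ne_top ?_ ?_
    · intro n hn
      rw [hdeg] at hn
      rw [hf, Polynomial.coeff_sub, Polynomial.coeff_X_pow, if_neg hn.ne, Polynomial.coeff_C]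
      split_ifs
      · simpa using Ideal.mem_map_of_mem C (h.mem m hm)
      · simp
    · rw [hf, Polynomial.coeff_sub, Polynomial.coeff_X_pow, if_neg hN.ne, Polynomial.coeff_C_zero,
        zero_sub, neg_mem_iff, ← Ideal.map_pow]
      intro H
      exact hy2 (by simpa using mem_map_C_iff.1 H 0)
  have hirr : Irreducible f := hE.irreducible hP hmonic.isPrimitive (hdeg ▸ hN)
  have hirr' := (hmonic.irreducible_iff_irreducible_map_fraction_map (K := F)).1 hirr
  have hmap : f.map (algebraMap (MvPolynomial (Fin d) D) F) = Polynomial.X ^ N -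
      Polynomial.C (algebraMap (MvPolynomial (Fin d) D) F (C y)) := by
    simp [hf]
  rw [hmap] at hirr'
  refine (minpoly.eq_of_irreducible_of_monic hirr' ?_ (hmap ▸ hmonic.map _)).symm
  simp only [map_sub, map_pow, Polynomial.aeval_X, Polynomial.aeval_C, hπ]
  rw [← IsScalarTower.algebraMap_apply, sub_self]

theorem exists_basis_of_root (h : DivisiblePrufer D y) [Algebra ℚ D] {N : ℕ} (hN : 0 < N) {π : E}
    (hπ : π ^ N = algebraMap (MvPolynomial (Fin d) D) E (C y))
    (htop : Algebra.adjoin F {π} = ⊤) :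
    ∃ (r : ℕ) (ω : Fin r → E), LinearIndependent F ω ∧
      (∀ k, IsIntegral (MvPolynomial (Fin d) D) (ω k)) ∧
      ∀ x, IsIntegral (MvPolynomial (Fin d) D) x →
        x ∈ Submodule.span (MvPolynomial (Fin d) D) (Set.range ω) := by
  have := h.isIntegrallyClosed
  have := isIntegrallyClosed_fin (D := D) d
  have : CharZero D := algebraRat.charZero D
  have : CharZero F := charZero_of_injective_algebraMap
    (IsFractionRing.injective (MvPolynomial (Fin d) D) F)
  have hN' : IsUnit (N : MvPolynomial (Fin d) D) := by
    have : IsUnit (algebraMap ℚ (MvPolynomial (Fin d) D) N) :=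
      (IsUnit.mk0 (N : ℚ) (by exact_mod_cast hN.ne')).map _
    simpa using this
  have hπI : IsIntegral (MvPolynomial (Fin d) D) π :=
    IsIntegral.of_pow hN (hπ ▸ isIntegral_algebraMap)
  rcases eq_or_ne y 0 with rfl | hy
  · have hπ0 : π = 0 := by
      rw [C_0, map_zero] at hπ
      exact eq_zero_of_pow_eq_zero hπ
    have hbot : (⊤ : Subalgebra F E) = ⊥ := by
      rw [← htop, hπ0]; simp
    refine ⟨1, fun _ => 1, ?_, fun _ => isIntegral_one, fun x hx => ?_⟩
    · exact LinearIndependent.of_subsingleton 0 one_ne_zero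
    · obtain ⟨a, rfl⟩ := Algebra.mem_bot.1 (hbot ▸ Algebra.mem_top (x := x))
      rw [isIntegral_algebraMap_iff (algebraMap F E).injective] at hx
      obtain ⟨b, rfl⟩ := IsIntegrallyClosed.isIntegral_iff.1 hx
      rw [← IsScalarTower.algebraMap_apply, Algebra.algebraMap_eq_smul_one]
      exact Submodule.smul_mem _ _ (Submodule.subset_span ⟨0, rfl⟩)
  · have hmin := h.minpoly_root hy hN (F := F) hπ
    have hmin' : (minpoly F π).natDegree = N := by
      rw [hmin, Polynomial.natDegree_X_pow_sub_C]
    refine ⟨N, fun i => π ^ (i : ℕ), hmin' ▸ linearIndependent_pow π, fun k => hπI.pow _,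
      fun x hx => ?_⟩
    have hcN : ∀ a : MvPolynomial (Fin d) D, C y ∣ a ^ N → C y ∣ a := fun a ha =>
      h.dvd_of_dvd_sq_mvPolynomial ha
    have hx' := mem_adjoin_of_isIntegral F (by simpa using hy) hN' hN hcN hπ htop hmin hx
    have hf : (Polynomial.X ^ N - Polynomial.C (C y : MvPolynomial (Fin d) D)).Monic :=
      Polynomial.monic_X_pow_sub_C _ hN.ne'
    have := Submodule.span_range_natDegree_eq_adjoin hf (x := π) (by simp [hπ])
    rw [← Subalgebra.mem_toSubmodule, ← this, Polynomial.natDegree_X_pow_sub_C] at hx'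
    refine Submodule.span_mono ?_ hx'
    intro z hz
    simp only [Finset.coe_image, Finset.coe_range, Set.mem_image, Set.mem_Iio] at hz
    obtain ⟨i, hi, rfl⟩ := hz
    exact ⟨⟨i, hi⟩, rfl⟩

end DivisiblePrufer

theorem exists_finsupp_sum_mul_apply {R E L : Type*} [CommRing R] [Field E] [Field L]
    [Algebra R L] [Algebra E L] [Fintype (L ≃ₐ[E] L)] [DecidableEq (L ≃ₐ[E] L)]
    (f : (L ≃ₐ[E] L) → R)
    (hf : ∀ σ ≠ 1, algebraMap R (integralClosure R L) (f σ) ∈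
      Ideal.span {z : integralClosure R L | ∃ b : integralClosure R L, (z : L) = b - σ b}) :
    ∃ c : integralClosure R L →₀ integralClosure R L, ∀ τ : L ≃ₐ[E] L,
      c.sum (fun b a => (a : L) * τ b) =
        if τ = 1 then algebraMap R L (∏ σ ∈ Finset.univ.erase 1, f σ) else 0 := by
  let S : Submonoid ((L ≃ₐ[E] L) → L) := MonoidHom.mrange
    (⟨⟨fun b τ => τ (b : L), by ext; simp⟩, by intros; ext; simp⟩ :
      integralClosure R L →* ((L ≃ₐ[E] L) → L))
  let T : Subalgebra (integralClosure R L) ((L ≃ₐ[E] L) → L) :=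
    Algebra.adjoin (integralClosure R L) (S : Set ((L ≃ₐ[E] L) → L))
  have hS : ∀ b : integralClosure R L, (fun τ : L ≃ₐ[E] L => τ (b : L)) ∈ T := fun b =>
    Algebra.subset_adjoin ⟨b, rfl⟩
  have hC : ∀ b : integralClosure R L, (fun _ : L ≃ₐ[E] L => (b : L)) ∈ T := fun b =>
    T.algebraMap_mem b
  have h1 : ∀ σ : L ≃ₐ[E] L, ∀ z ∈ Ideal.span
      {z : integralClosure R L | ∃ b : integralClosure R L, (z : L) = b - σ b},
      ∃ φ ∈ T, φ 1 = 0 ∧ φ σ = z := by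
    intro σ z hz
    induction hz using Submodule.span_induction with
    | mem z hz =>
      obtain ⟨b, hb⟩ := hz
      exact ⟨_, sub_mem (hC b) (hS b), by simp, by simp [hb]⟩
    | zero => exact ⟨0, zero_mem _, rfl, rfl⟩
    | add x y _ _ hx hy =>
      obtain ⟨φ, h1, h2, h3⟩ := hx
      obtain ⟨ψ, g1, g2, g3⟩ := hy
      exact ⟨φ + ψ, add_mem h1 g1, by simp [h2, g2], by simp [h3, g3]⟩
    | smul a x _ hx =>
      obtain ⟨φ, h1, h2, h3⟩ := hx
      exact ⟨_, mul_mem (hC a) h1, by simp [h2], by simp [h3]⟩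
  have h2 : ∀ σ : L ≃ₐ[E] L, ∃ ψ ∈ T, σ ≠ 1 → ψ 1 = algebraMap R L (f σ) ∧ ψ σ = 0 := by
    intro σ
    by_cases hσ : σ = 1
    · exact ⟨0, zero_mem _, fun H => absurd hσ H⟩
    · obtain ⟨φ, e1, e2, e3⟩ := h1 σ _ (hf σ hσ)
      refine ⟨_, sub_mem (hC (algebraMap R _ (f σ))) e1, fun _ => ⟨?_, ?_⟩⟩
      · simp only [Pi.sub_apply, e2, sub_zero]; rfl
      · simp only [Pi.sub_apply, e3, sub_self]
  choose ψ hψT hψ using h2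
  have hmem : ∏ σ ∈ Finset.univ.erase 1, ψ σ ∈ T := prod_mem fun σ _ => hψT σ
  rw [← Subalgebra.mem_toSubmodule, Algebra.adjoin_eq_span, Submonoid.closure_eq,
    MonoidHom.coe_mrange, Finsupp.mem_span_range_iff_exists_finsupp] at hmem
  obtain ⟨c, hc⟩ := hmem
  refine ⟨c, fun τ => ?_⟩
  have := congrFun hc τ
  rw [Finsupp.sum, Finset.sum_apply, Finset.prod_apply] at this
  rw [Finsupp.sum]
  refine Eq.trans this ?_
  split_ifs with hτ
  · subst hτ
    rw [map_prod]
    exact Finset.prod_congr rfl fun σ hσ => (hψ σ (Finset.ne_of_mem_erase hσ)).1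
  · exact Finset.prod_eq_zero (Finset.mem_erase.2 ⟨hτ, Finset.mem_univ τ⟩) (hψ τ hτ).2

namespace DivisiblePrufer

variable {D : Type*} [CommRing D] [IsDomain D] {y : D} {d : ℕ}

section Almost

variable {L : Type*} [Field L] [Algebra (MvPolynomial (Fin d) D) L]

variable (D d L) in
/-- The elements which become integral after multiplication by a nonzero constant, and after
multiplication by a unimodular polynomial. -/
def almostIntegral : Subalgebra (MvPolynomial (Fin d) D) L where
  carrier := {x | (∃ c : D, c ≠ 0 ∧ IsIntegral (MvPolynomial (Fin d) D)
      ((C c : MvPolynomial (Fin d) D) • x)) ∧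
    ∃ f ∈ unimodular (Fin d) D, IsIntegral (MvPolynomial (Fin d) D) (f • x)}
  mul_mem' := by
    rintro a b ⟨⟨c, hc, hca⟩, f, hf, hfa⟩ ⟨⟨c', hc', hca'⟩, f', hf', hfa'⟩
    refine ⟨⟨c * c', mul_ne_zero hc hc', ?_⟩, f * f', mul_mem hf hf', ?_⟩
    · rw [C_mul, ← smul_mul_smul_comm]
      exact hca.mul hca'
    · rw [← smul_mul_smul_comm]
      exact hfa.mul hfa'
  add_mem' := by
    rintro a b ⟨⟨c, hc, hca⟩, f, hf, hfa⟩ ⟨⟨c', hc', hca'⟩, f', hf', hfa'⟩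
    refine ⟨⟨c * c', mul_ne_zero hc hc', ?_⟩, f * f', mul_mem hf hf', ?_⟩
    · rw [C_mul, smul_add, mul_smul, mul_smul, smul_comm (C c)]
      exact (hca.smul _).add (hca'.smul _)
    · rw [smul_add, mul_smul, mul_smul, smul_comm f]
      exact (hfa.smul _).add (hfa'.smul _)
  algebraMap_mem' r := ⟨⟨1, one_ne_zero, by simpa using isIntegral_algebraMap⟩, 1, one_mem _,
    by simpa using isIntegral_algebraMap⟩

theorem finite_integralClosure_of_almostIntegral_le (h : DivisiblePrufer D y) (V : Finset L)
    (hV : Subalgebra.toSubmodule (almostIntegral D d L) ≤ Submodule.span _ (V : Set L))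
    {f : MvPolynomial (Fin d) D} (hf : f ∈ unimodular (Fin d) D)
    (hfV : ∀ v ∈ V, IsIntegral (MvPolynomial (Fin d) D) (f • v)) :
    Module.Finite (MvPolynomial (Fin d) D) (integralClosure (MvPolynomial (Fin d) D) L) := by
  let v : Fin V.card → L := fun i => V.equivFin.symm i
  let Ψ := Fintype.linearCombination (MvPolynomial (Fin d) D) v
  have hΨ : LinearMap.range Ψ = Submodule.span _ (V : Set L) := by
    rw [Fintype.range_linearCombination]
    congr 1
    ext z
    constructor
    · rintro ⟨i, rfl⟩
      exact (V.equivFin.symm i).2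
    · intro hz
      exact ⟨V.equivFin ⟨z, hz⟩, by simp [v]⟩
  have hΨf : ∀ a, IsIntegral (MvPolynomial (Fin d) D) (f • Ψ a) := by
    intro a
    rw [Fintype.linearCombination_apply, Finset.smul_sum]
    refine IsIntegral.sum _ fun i _ => ?_
    rw [smul_comm]
    exact (hfV _ (V.equivFin.symm i).2).smul _
  have hN : ((Subalgebra.toSubmodule (almostIntegral D d L)).comap Ψ).FG := by
    refine h.fg_of_saturated fun c hc a ha => ?_
    obtain ⟨⟨c', hc', hI⟩, -⟩ := ha
    refine ⟨⟨c' * c, mul_ne_zero hc' hc, ?_⟩, f, hf, hΨf a⟩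
    rwa [C_mul, mul_smul, ← map_smul]
  have hfg : (Subalgebra.toSubmodule (almostIntegral D d L)).FG := by
    have := hN.map Ψ
    rwa [Submodule.map_comap_eq_of_le (hΨ ▸ hV)] at this
  have heq : integralClosure (MvPolynomial (Fin d) D) L = almostIntegral D d L := by
    refine le_antisymm (fun x hx => ?_) fun x hx => IsIntegral.of_mem_of_fg _ hfg x hx
    have hx : IsIntegral (MvPolynomial (Fin d) D) x := hx
    exact ⟨⟨1, one_ne_zero, by simpa using hx⟩, 1, one_mem _, by simpa using hx⟩
  rw [heq]
  exact Module.Finite.iff_fg.2 hfg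

end Almost

variable {F L : Type*} [Field F] [Field L] [Algebra (MvPolynomial (Fin d) D) F]
  [IsFractionRing (MvPolynomial (Fin d) D) F] [Algebra F L] [Algebra (MvPolynomial (Fin d) D) L]
  [IsScalarTower (MvPolynomial (Fin d) D) F L]

theorem mem_span_of_mem_almostIntegral (h : DivisiblePrufer D y) {r : ℕ} {ω : Fin r → L}
    (hω : LinearIndependent F ω)
    (hωs : ∀ x, IsIntegral (MvPolynomial (Fin d) D) x →
        x ∈ Submodule.span (MvPolynomial (Fin d) D) (Set.range ω))
    {e : L} (he : e ∈ almostIntegral D d L) :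
    e ∈ Submodule.span (MvPolynomial (Fin d) D) (Set.range ω) := by
  obtain ⟨⟨c, hc, hce⟩, f, hf, hfe⟩ := he
  have hinj : Function.Injective (algebraMap (MvPolynomial (Fin d) D) L) := by
    rw [IsScalarTower.algebraMap_eq _ F L]
    exact (algebraMap F L).injective.comp (IsFractionRing.injective _ F)
  have hω' : LinearIndependent (MvPolynomial (Fin d) D) ω := by
    refine hω.restrict_scalars ?_
    simpa [← Algebra.algebraMap_eq_smul_one] using IsFractionRing.injective _ F
  obtain ⟨a, ha⟩ := (Submodule.mem_span_range_iff_exists_fun _).1 (hωs _ hce)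
  obtain ⟨b, hb⟩ := (Submodule.mem_span_range_iff_exists_fun _).1 (hωs _ hfe)
  have hab : ∀ k, f * a k = C c * b k := by
    have : ∑ k, (f * a k - C c * b k) • ω k = 0 := by
      simp only [sub_smul, mul_smul, Finset.sum_sub_distrib, ← Finset.smul_sum, ha, hb]
      rw [smul_comm, sub_self]
    intro k
    exact sub_eq_zero.1 (Fintype.linearIndependent_iff.1 hω' _ this k)
  have hdvd : ∀ k, C c ∣ a k := fun k => h.C_dvd_of_dvd_mul hf ⟨_, hab k⟩
  choose a' ha' using hdvd
  have hc' : algebraMap (MvPolynomial (Fin d) D) L (C c) ≠ 0 := by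
    rw [Ne, map_eq_zero_iff _ hinj]; simpa using hc
  refine (Submodule.mem_span_range_iff_exists_fun _).2 ⟨a', mul_left_cancel₀ hc' ?_⟩
  rw [← Algebra.smul_def, ← Algebra.smul_def, ← ha, Finset.smul_sum]
  exact Finset.sum_congr rfl fun k _ => by rw [ha', mul_smul]

theorem finite_integralClosure_of_isGalois (h : DivisiblePrufer D y) [Algebra ℚ D]
    [FiniteDimensional F L] (E L₀ : IntermediateField F L) [IsGalois E L] {n : ℕ}
    (hdeg : ∀ x ∈ L₀, (minpoly F x).natDegree ≤ n)
    (hL₀ : ∀ τ : L ≃ₐ[F] L, ∀ x ∈ L₀, τ x ∈ L₀)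
    (hE : ∀ l, 0 < l → l ≤ n →
      ∃ e ∈ E, e ^ l = algebraMap _ L (C y : MvPolynomial (Fin d) D))
    (hsup : L₀ ⊔ E = ⊤) {r : ℕ} {ω : Fin r → E} (hω : LinearIndependent F ω)
    (hωI : ∀ k, IsIntegral (MvPolynomial (Fin d) D) (ω k))
    (hωs : ∀ x : E, IsIntegral (MvPolynomial (Fin d) D) x →
        x ∈ Submodule.span (MvPolynomial (Fin d) D) (Set.range ω)) :
    Module.Finite (MvPolynomial (Fin d) D) (integralClosure (MvPolynomial (Fin d) D) L) := by
  classical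
  have := h.isIntegrallyClosed
  have := isIntegrallyClosed_fin (D := D) d
  have : IsScalarTower (MvPolynomial (Fin d) D) E L := .of_algebraMap_eq fun _ => rfl
  have : Fintype (L ≃ₐ[E] L) := Fintype.ofFinite _
  have hf : ∀ σ : L ≃ₐ[E] L, ∃ f ∈ unimodular (Fin d) D, σ ≠ 1 →
      algebraMap _ (integralClosure (MvPolynomial (Fin d) D) L) f ∈
      Ideal.span {z : integralClosure (MvPolynomial (Fin d) D) L |
        ∃ b : integralClosure (MvPolynomial (Fin d) D) L, (z : L) = b - σ b} := by
    intro σ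
    by_cases hσ : σ = 1
    · exact ⟨1, one_mem _, fun H => absurd hσ H⟩
    · have hσ' : ∃ x ∈ L₀, σ x ≠ x := by
        by_contra! H
        refine hσ (AlgEquiv.ext fun x => ?_)
        let K : IntermediateField F L := IntermediateField.fixedField
          (Subgroup.zpowers (σ.restrictScalars F))
        have hmem : ∀ z, σ z = z → z ∈ K := by
          rintro z hz ⟨g, hg⟩
          have : Subgroup.zpowers (σ.restrictScalars F) ≤
              MulAction.stabilizer (L ≃ₐ[F] L) z := by
            rw [Subgroup.zpowers_le]; exact hz
          exact this hg
        have hK : L₀ ⊔ E ≤ K :=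
          sup_le (fun z hz => hmem z (H z hz)) fun z hz => hmem z (σ.commutes ⟨z, hz⟩)
        have hx : x ∈ K := hK (hsup ▸ IntermediateField.mem_top)
        exact hx ⟨σ.restrictScalars F, Subgroup.mem_zpowers _⟩
      obtain ⟨f, hf1, hf2⟩ := h.exists_mem_unimodular ((Ideal.span
          {z : integralClosure (MvPolynomial (Fin d) D) L |
            ∃ b : integralClosure (MvPolynomial (Fin d) D) L, (z : L) = b - σ b}).comap
              (algebraMap (MvPolynomial (Fin d) D) _)) fun m hm => by
        obtain ⟨f, hfm, hf⟩ := h.exists_mem_span_sub hm E L₀ hdeg hL₀ hE (σ.restrictScalars F)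
          (fun e he => σ.commutes ⟨e, he⟩) hσ'
        exact ⟨f, hf, hfm⟩
      exact ⟨f, hf2, fun _ => hf1⟩
  choose f hfS hf using hf
  obtain ⟨c, hc⟩ := exists_finsupp_sum_mul_apply f hf
  set f₀ := ∏ σ ∈ Finset.univ.erase 1, f σ with hf₀
  have hf₀S : f₀ ∈ unimodular (Fin d) D := prod_mem fun σ _ => hfS σ
  have hinj : Function.Injective (algebraMap (MvPolynomial (Fin d) D) L) := by
    rw [IsScalarTower.algebraMap_eq _ F L]
    exact (algebraMap F L).injective.comp (IsFractionRing.injective _ F)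
  have hf₀0 : algebraMap (MvPolynomial (Fin d) D) L f₀ ≠ 0 := by
    rw [Ne, map_eq_zero_iff _ hinj]
    exact ne_zero_of_mem_unimodular hf₀S
  have htr : ∀ x : L, c.sum (fun b a => (a : L) * (Algebra.trace E L (x * b) : E)) = f₀ • x := by
    intro x
    calc _ = c.sum (fun b a => ∑ τ : L ≃ₐ[E] L, τ x * ((a : L) * τ b)) := by
          refine Finset.sum_congr rfl fun b _ => ?_
          have := trace_eq_sum_automorphisms (K := E) (x * (b : L))
          rw [IntermediateField.algebraMap_apply] at this
          beta_reduce
          rw [this, Finset.mul_sum]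
          refine Finset.sum_congr ?_ fun τ _ => by rw [map_mul]; ring
          congr!
      _ = ∑ τ : L ≃ₐ[E] L, τ x * c.sum (fun b a => (a : L) * τ b) := by
          simp only [Finsupp.sum, Finset.mul_sum]
          exact Finset.sum_comm
      _ = f₀ • x := by
          simp [hc, Algebra.smul_def, mul_comm]
  refine h.finite_integralClosure_of_almostIntegral_le
    ((c.support ×ˢ Finset.univ).image fun p : _ × Fin r =>
      (algebraMap _ L f₀)⁻¹ * (c p.1 * ω p.2)) ?_ hf₀S ?_
  · intro x hx
    have hx' : ∀ b : integralClosure (MvPolynomial (Fin d) D) L,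
        Algebra.trace E L (x * b) ∈ almostIntegral D d E := by
      intro b
      have key : ∀ g : MvPolynomial (Fin d) D, IsIntegral (MvPolynomial (Fin d) D) (g • x) →
          IsIntegral (MvPolynomial (Fin d) D) (g • Algebra.trace E L (x * b)) := by
        intro g hg
        rw [← LinearMap.map_smul_of_tower, ← smul_mul_assoc]
        exact Algebra.isIntegral_trace (hg.mul b.2)
      obtain ⟨⟨s, hs, hsx⟩, g, hg, hgx⟩ := hx
      exact ⟨⟨s, hs, key _ hsx⟩, g, hg, key _ hgx⟩
    have e : x = (algebraMap _ L f₀)⁻¹ * (f₀ • x) := by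
      rw [Algebra.smul_def, inv_mul_cancel_left₀ hf₀0]
    rw [e, ← htr x, Finsupp.sum, Finset.mul_sum]
    refine Submodule.sum_mem _ fun b hb => ?_
    obtain ⟨a, ha⟩ := (Submodule.mem_span_range_iff_exists_fun _).1
      (h.mem_span_of_mem_almostIntegral hω hωs (hx' b))
    have e2 : ((Algebra.trace E L (x * b) : E) : L) = ∑ k, a k • (ω k : L) := by
      rw [← ha]
      exact map_sum (E.val.restrictScalars (MvPolynomial (Fin d) D)) _ _
    rw [e2, Finset.mul_sum, Finset.mul_sum]
    refine Submodule.sum_mem _ fun k _ => ?_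
    rw [mul_smul_comm, mul_smul_comm]
    refine Submodule.smul_mem _ _ (Submodule.subset_span ?_)
    exact Finset.mem_coe.2 (Finset.mem_image.2 ⟨(b, k), by simp [hb], rfl⟩)
  · intro v hv
    obtain ⟨⟨b, k⟩, -, rfl⟩ := Finset.mem_image.1 hv
    rw [Algebra.smul_def, mul_inv_cancel_left₀ hf₀0]
    exact (c b).2.mul ((hωI k).map (E.val.restrictScalars (MvPolynomial (Fin d) D)))

end DivisiblePrufer

namespace DivisiblePrufer

variable {D : Type*} [CommRing D] [IsDomain D] {y : D} {d : ℕ}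

theorem fg_of_saturated_of_finite (h : DivisiblePrufer D y) {M : Type*} [AddCommGroup M]
    [Module (MvPolynomial (Fin d) D) M] [Module.Finite (MvPolynomial (Fin d) D) M]
    {N : Submodule (MvPolynomial (Fin d) D) M}
    (hN : ∀ c : D, c ≠ 0 → ∀ x, (C c : MvPolynomial (Fin d) D) • x ∈ N → x ∈ N) : N.FG := by
  obtain ⟨r, Ψ, hΨ⟩ := Module.Finite.exists_fin' (MvPolynomial (Fin d) D) M
  have := (h.fg_of_saturated (N := N.comap Ψ) fun c hc x hx => hN c hc _ (by
    rw [← map_smul]; exact hx)).map Ψ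
  rwa [Submodule.map_comap_eq_of_surjective hΨ] at this

variable (F : Type*) [Field F] [Algebra (MvPolynomial (Fin d) D) F]
  [IsFractionRing (MvPolynomial (Fin d) D) F]

theorem finite_integralClosure_of_sup_eq_top (h : DivisiblePrufer D y) [Algebra ℚ D]
    {L : Type*} [Field L] [Algebra F L] [Algebra (MvPolynomial (Fin d) D) L]
    [IsScalarTower (MvPolynomial (Fin d) D) F L] [FiniteDimensional F L]
    (L₀ : IntermediateField F L) [IsGalois F L₀] {π : L}
    (hπ : π ^ (Module.finrank F L₀).factorial = algebraMap (MvPolynomial (Fin d) D) L (C y))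
    (hsup : L₀ ⊔ IntermediateField.adjoin F {π} = ⊤) :
    Module.Finite (MvPolynomial (Fin d) D) (integralClosure (MvPolynomial (Fin d) D) L) := by
  have hπI : IsIntegral F π := Algebra.IsIntegral.isIntegral π
  have htop := (IntermediateField.adjoin.powerBasis hπI).adjoin_gen_eq_top
  rw [IntermediateField.adjoin.powerBasis_gen] at htop
  have hgen : IntermediateField.AdjoinSimple.gen F π ^ (Module.finrank F L₀).factorial =
      algebraMap (MvPolynomial (Fin d) D) (IntermediateField.adjoin F {π}) (C y) :=
    Subtype.ext hπ
  obtain ⟨r, ω, hω, hωI, hωs⟩ := h.exists_basis_of_root (Nat.factorial_pos _) hgen htop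
  have : IsGalois (IntermediateField.adjoin F {π}) L := IsGalois.sup_right L₀ _ hsup
  refine h.finite_integralClosure_of_isGalois (IntermediateField.adjoin F {π}) L₀
    (n := Module.finrank F L₀) (fun x hx => ?_) (fun τ x hx => ?_) (fun l hl hln => ?_) hsup
    hω hωI hωs
  · have := minpoly.natDegree_le (A := F) (⟨x, hx⟩ : L₀)
    rwa [IntermediateField.minpoly_eq] at this
  · have := AlgHom.restrictNormal_commutes (τ : L →ₐ[F] L) L₀ ⟨x, hx⟩
    exact this ▸ ((τ : L →ₐ[F] L).restrictNormal L₀ ⟨x, hx⟩).2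
  · refine ⟨π ^ ((Module.finrank F L₀).factorial / l),
      pow_mem (IntermediateField.mem_adjoin_simple_self F π) _, ?_⟩
    rw [← pow_mul, Nat.div_mul_cancel (Nat.dvd_factorial hl hln), hπ]

/-- The integral closure of `D[z]` in a finite extension of its fraction field is finite. -/
theorem finite_integralClosure (h : DivisiblePrufer D y) [Algebra ℚ D]
    (L : Type*) [Field L] [Algebra F L] [Algebra (MvPolynomial (Fin d) D) L]
    [IsScalarTower (MvPolynomial (Fin d) D) F L] [FiniteDimensional F L] :
    Module.Finite (MvPolynomial (Fin d) D) (integralClosure (MvPolynomial (Fin d) D) L) := by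
  have : CharZero D := algebraRat.charZero D
  have : CharZero F := charZero_of_injective_algebraMap
    (IsFractionRing.injective (MvPolynomial (Fin d) D) F)
  let Ω := AlgebraicClosure L
  have : IsScalarTower (MvPolynomial (Fin d) D) F Ω :=
    .of_algebraMap_eq fun x => by
      rw [IsScalarTower.algebraMap_apply (MvPolynomial (Fin d) D) L Ω,
        IsScalarTower.algebraMap_apply (MvPolynomial (Fin d) D) F L,
        ← IsScalarTower.algebraMap_apply F L Ω]
  have : Algebra.IsAlgebraic F Ω := Algebra.IsAlgebraic.trans F L Ω
  have : Normal F Ω := normal_iff.2 fun x =>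
    ⟨Algebra.IsIntegral.isIntegral x, IsAlgClosed.splits _⟩
  let K := IntermediateField.normalClosure F L Ω
  have : IsGalois F K := {}
  obtain ⟨π, hπ⟩ := IsAlgClosed.exists_pow_nat_eq
    (algebraMap (MvPolynomial (Fin d) D) Ω (C y)) (Nat.factorial_pos (Module.finrank F K))
  have : FiniteDimensional F (IntermediateField.adjoin F {π}) :=
    IntermediateField.adjoin.finiteDimensional (Algebra.IsIntegral.isIntegral π)
  let L₁ : IntermediateField F Ω := K ⊔ IntermediateField.adjoin F {π}
  have hKL : K ≤ L₁ := le_sup_left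
  have hπL : IntermediateField.adjoin F {π} ≤ L₁ := le_sup_right
  let K₀ : IntermediateField F L₁ := IntermediateField.restrict hKL
  let eK : K ≃ₐ[F] K₀ := IntermediateField.restrictAlgEquiv hKL
  have : IsGalois F K₀ := IsGalois.of_algEquiv eK
  let π₁ : L₁ := ⟨π, hπL (IntermediateField.mem_adjoin_simple_self F π)⟩
  have hsup : K₀ ⊔ IntermediateField.adjoin F {π₁} = ⊤ := by
    rw [← IntermediateField.lift_inj, IntermediateField.lift_top, IntermediateField.lift_sup,
      IntermediateField.lift_restrict, IntermediateField.lift_adjoin_simple]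
  have hπ₁ : π₁ ^ (Module.finrank F K₀).factorial =
      algebraMap (MvPolynomial (Fin d) D) L₁ (C y) := by
    rw [← eK.toLinearEquiv.finrank_eq]
    exact Subtype.ext hπ
  have hfin := h.finite_integralClosure_of_sup_eq_top F K₀ hπ₁ hsup
  let j : L →ₐ[F] L₁ := (IntermediateField.inclusion hKL).comp
    ((IsScalarTower.toAlgHom F L Ω).codRestrict K.toSubalgebra
      fun x => (IsScalarTower.toAlgHom F L Ω).fieldRange_le_normalClosure ⟨x, rfl⟩)
  let g := ((j.restrictScalars (MvPolynomial (Fin d) D)).mapIntegralClosure).toLinearMap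
  have hinj : Function.Injective (algebraMap (MvPolynomial (Fin d) D) L) := by
    rw [IsScalarTower.algebraMap_eq _ F L]
    exact (algebraMap F L).injective.comp (IsFractionRing.injective _ F)
  have hg : Function.Injective g := fun a b hab =>
    Subtype.ext (j.injective (congrArg Subtype.val hab))
  have hfg : (LinearMap.range g).FG := by
    refine h.fg_of_saturated_of_finite fun c hc x hx => ?_
    obtain ⟨b, hb⟩ := hx
    have hc0 : algebraMap (MvPolynomial (Fin d) D) L (C c) ≠ 0 := by
      rw [Ne, map_eq_zero_iff _ hinj]; simpa using hc
    have hb' : j (b : L) = algebraMap (MvPolynomial (Fin d) D) L₁ (C c) * (x : L₁) := by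
      rw [← Algebra.smul_def]
      exact congrArg Subtype.val hb
    have hj : ∀ r : MvPolynomial (Fin d) D, j (algebraMap _ L r) = algebraMap _ L₁ r :=
      (j.restrictScalars (MvPolynomial (Fin d) D)).commutes
    have hx : j ((algebraMap (MvPolynomial (Fin d) D) L (C c))⁻¹ * b) = x := by
      rw [map_mul, map_inv₀, hb', ← hj, inv_mul_cancel_left₀]
      exact fun H => hc0 (j.injective (H.trans (map_zero j).symm))
    refine ⟨⟨(algebraMap (MvPolynomial (Fin d) D) L (C c))⁻¹ * b, ?_⟩, Subtype.ext hx⟩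
    rw [mem_integralClosure_iff, ← isIntegral_algHom_iff
      (j.restrictScalars (MvPolynomial (Fin d) D)) j.injective]
    exact hx ▸ x.2
  have := Module.Finite.iff_fg.2 hfg
  exact Module.Finite.equiv (LinearEquiv.ofInjective g hg).symm

end DivisiblePrufer

namespace MvPolynomial.IsHomogeneous

variable {σ R S : Type*} [CommRing R] [CommRing S] [Algebra R S] {φ : MvPolynomial σ R} {n : ℕ}

theorem aeval_mul_right (hφ : φ.IsHomogeneous n) (u : σ → S) (c : S) :
    MvPolynomial.aeval (fun i => u i * c) φ = MvPolynomial.aeval u φ * c ^ n := by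
  simp only [aeval_def, eval₂_eq, mul_pow, Finset.prod_mul_distrib, Finset.prod_pow_eq_pow_sum,
    Finset.sum_mul]
  refine Finset.sum_congr rfl fun α hα => ?_
  rw [hφ.degree_eq_sum_deg_support hα, mul_assoc]

theorem natDegree_aeval_le (hφ : φ.IsHomogeneous n) (p : σ → Polynomial S)
    (hp : ∀ i, (p i).natDegree ≤ 1) :
    (MvPolynomial.aeval p φ).natDegree ≤ n ∧
      (MvPolynomial.aeval p φ).coeff n = MvPolynomial.aeval (fun i => (p i).coeff 1) φ := by
  classical
  have key : ∀ (α : σ →₀ ℕ) (s : Finset σ),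
      (∏ i ∈ s, p i ^ α i).natDegree ≤ ∑ i ∈ s, α i ∧
        (∏ i ∈ s, p i ^ α i).coeff (∑ i ∈ s, α i) = ∏ i ∈ s, (p i).coeff 1 ^ α i := by
    intro α s
    induction s using Finset.induction_on with
    | empty => simp
    | insert i s hi ih =>
      have h1 : (p i ^ α i).natDegree ≤ α i := by
        simpa using Polynomial.natDegree_pow_le_of_le (α i) (hp i)
      have h2 : (p i ^ α i).coeff (α i) = (p i).coeff 1 ^ α i := by
        simpa using Polynomial.coeff_pow_of_natDegree_le (m := α i) (hp i)
      rw [Finset.prod_insert hi, Finset.sum_insert hi, Finset.prod_insert hi]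
      refine ⟨Polynomial.natDegree_mul_le_of_le h1 ih.1, ?_⟩
      rw [Polynomial.coeff_mul_add_eq_of_natDegree_le h1 ih.1, h2, ih.2]
  have hsum : MvPolynomial.aeval p φ = ∑ α ∈ φ.support,
      Polynomial.C (algebraMap R S (coeff α φ)) * ∏ i ∈ α.support, p i ^ α i := by
    rw [aeval_def, eval₂_eq]; rfl
  rw [hsum]
  constructor
  · refine Polynomial.natDegree_sum_le_of_forall_le _ _ fun α hα => ?_
    refine (Polynomial.natDegree_C_mul_le _ _).trans ?_
    rw [hφ.degree_eq_sum_deg_support hα]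
    exact (key α _).1
  · rw [Polynomial.finsetSum_coeff, aeval_def, eval₂_eq]
    refine Finset.sum_congr rfl fun α hα => ?_
    rw [Polynomial.coeff_C_mul, hφ.degree_eq_sum_deg_support hα, (key α _).2]

end MvPolynomial.IsHomogeneous

theorem IsIntegral.of_adjoin {D A : Type*} [CommRing D] [CommRing A] [Algebra D A] {s : Set A}
    {T : Subalgebra D A} (hs : ∀ x ∈ s, IsIntegral T x) {z : A}
    (hz : IsIntegral (Algebra.adjoin D s) z) : IsIntegral T z := by
  let U : Subalgebra D A := (integralClosure T A).restrictScalars D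
  have hle : Algebra.adjoin D s ≤ U := Algebra.adjoin_le hs
  have hz' : IsIntegral (integralClosure T A) z := by
    have := hz.map_of_comp_eq (Subalgebra.inclusion hle).toRingHom (RingHom.id A) rfl
    exact this
  exact isIntegral_trans z hz'

namespace DivisiblePrufer

variable {D : Type*} [CommRing D] {y : D}

theorem exists_eval_eq_one (h : DivisiblePrufer D y) [Algebra ℚ D] {n q : ℕ}
    (I : Submodule D (MvPolynomial (Fin (n + 1)) D)) (hI : ∀ φ ∈ I, φ.IsHomogeneous q)
    (hm : ∀ m : Ideal D, m.IsMaximal → ∃ φ ∈ I, ∃ α, coeff α φ ∉ m) :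
    ∃ t : Fin n → D, ∃ φ ∈ I, eval (Fin.cons 1 t) φ = 1 := by
  suffices H : ∃ t : Fin n → D, ∀ m : Ideal D, m.IsMaximal →
      ∃ φ ∈ I, eval (Fin.cons 1 t) φ ∉ m by
    obtain ⟨t, ht⟩ := H
    let J : Ideal D := I.map (aeval (Fin.cons 1 t : Fin (n + 1) → D)).toLinearMap
    have hJ : J = ⊤ := J.eq_top_of_forall_isMaximal fun m hm => by
      obtain ⟨φ, hφ, hφm⟩ := ht m hm
      exact ⟨eval (Fin.cons 1 t) φ, hφm, φ, hφ, rfl⟩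
    obtain ⟨φ, hφ, e⟩ := (Ideal.eq_top_iff_one _).1 hJ
    exact ⟨t, φ, hφ, e⟩
  refine h.patch (fun t m => ∃ φ ∈ I, eval (Fin.cons 1 t) φ ∉ m) ?_ ?_
  · rintro m hm t t' htt' ⟨φ, hφ, hφm⟩
    refine ⟨φ, hφ, fun H => hφm ?_⟩
    have hmem : ∀ i, Ideal.Quotient.mk m (t i) = Ideal.Quotient.mk m (t' i) := by
      intro i
      rw [Ideal.Quotient.eq]
      have : (t - t') i ∈ m • (⊤ : Submodule D D) := by
        refine Submodule.smul_induction_on htt'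
          (p := fun z : Fin n → D => z i ∈ m • (⊤ : Submodule D D))
          (fun a ha b _ => Submodule.smul_mem_smul ha trivial) fun a b ha hb => add_mem ha hb
      simpa using this
    have e : ∀ t : Fin n → D, Ideal.Quotient.mk m (eval (Fin.cons 1 t) φ) =
        eval₂ (Ideal.Quotient.mk m) (Fin.cons 1 fun i => Ideal.Quotient.mk m (t i)) φ := by
      intro t
      rw [eval, coe_eval₂Hom, eval₂_comp_left]
      congr 1
      funext i
      refine Fin.cases ?_ (fun i => ?_) i <;> simp
    rw [← Ideal.Quotient.eq_zero_iff_mem, e] at H ⊢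
    rwa [← funext hmem]
  · intro m hmax
    obtain ⟨φ, hφ, α, hα⟩ := hm m hmax
    let _ := Ideal.Quotient.field m
    have : CharZero (D ⧸ m) := algebraRat.charZero _
    have hφ0 : φ.map (Ideal.Quotient.mk m) * X 0 ≠ 0 := by
      refine mul_ne_zero (fun H => hα ?_) (X_ne_zero 0)
      have := congrArg (coeff α) H
      rwa [coeff_map, coeff_zero, Ideal.Quotient.eq_zero_iff_mem] at this
    obtain ⟨u, hu⟩ : ∃ u, eval u (φ.map (Ideal.Quotient.mk m) * X 0) ≠ 0 := by
      by_contra! H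
      exact hφ0 (MvPolynomial.funext fun x => by rw [H, map_zero])
    rw [map_mul, eval_X] at hu
    have hu0 : u 0 ≠ 0 := right_ne_zero_of_mul hu
    choose t ht using fun i : Fin n => Ideal.Quotient.mk_surjective (I := m) (u i.succ * (u 0)⁻¹)
    refine ⟨t, eval (Fin.cons 1 t) φ, ?_, fun m' _ hm' => ⟨φ, hφ, hm'⟩⟩
    rw [← Ideal.Quotient.eq_zero_iff_mem, eval, coe_eval₂Hom, eval₂_comp_left]
    have e : (Ideal.Quotient.mk m ∘ (Fin.cons 1 t : Fin (n + 1) → D)) =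
        fun i => u i * (u 0)⁻¹ := by
      funext i
      refine Fin.cases ?_ (fun i => ?_) i
      · simp [hu0]
      · simp [ht]
    have e2 := ((hI φ hφ).map (Ideal.Quotient.mk m)).aeval_mul_right u (u 0)⁻¹
    simp only [MvPolynomial.aeval_def, eval₂_map] at e2
    rw [e, RingHom.comp_id]
    intro H
    have e3 : eval u (φ.map (Ideal.Quotient.mk m)) * (u 0)⁻¹ ^ q = 0 := by
      rw [eval, coe_eval₂Hom, eval₂_map, ← H]
      exact e2.symm
    exact mul_ne_zero (left_ne_zero_of_mul hu) (pow_ne_zero _ (inv_ne_zero hu0)) e3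

end DivisiblePrufer

theorem MvPolynomial.exists_homogeneousComponent_ne_zero {σ R : Type*} [CommSemiring R]
    {G : MvPolynomial σ R} (hG : G ≠ 0) : ∃ q, homogeneousComponent q G ≠ 0 := by
  by_contra! H
  exact hG (by rw [← sum_homogeneousComponent G]; exact Finset.sum_eq_zero fun i _ => H i)

theorem MvPolynomial.aeval_homogeneousComponent_eq_zero {σ R A : Type*} [CommRing R] [CommRing A]
    [Algebra R A] {a : σ → A} {G : MvPolynomial σ R}
    (hG : aeval (fun i => Polynomial.C (a i) * Polynomial.X) G = 0) (q : ℕ) :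
    aeval a (homogeneousComponent q G) = 0 := by
  have key : ∀ i, aeval (fun j => Polynomial.C (a j) * Polynomial.X) (homogeneousComponent i G) =
      Polynomial.C (aeval a (homogeneousComponent i G)) * Polynomial.X ^ i := by
    intro i
    rw [(homogeneousComponent_isHomogeneous i G).aeval_mul_right (fun j => Polynomial.C (a j))]
    exact congrArg (· * _) (comp_aeval_apply a (Polynomial.CAlgHom (R := R) (A := A)) _).symm
  have h0 := congrArg (fun p => Polynomial.coeff p q) hG
  rw [← sum_homogeneousComponent G, map_sum, Polynomial.finsetSum_coeff] at h0
  simp only [key, Polynomial.coeff_C_mul, Polynomial.coeff_X_pow, mul_ite, mul_one, mul_zero,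
    Polynomial.coeff_zero, Finset.sum_ite_eq, Finset.mem_range] at h0
  split_ifs at h0 with hq
  · exact h0
  · rw [homogeneousComponent_eq_zero _ _ (by omega), map_zero]

namespace DivisiblePrufer

variable {D : Type*} [CommRing D] [IsDomain D] {y : D}

theorem exists_noether_normalization (h : DivisiblePrufer D y) [Algebra ℚ D] {A : Type*}
    [CommRing A] [IsDomain A] [Algebra D A] (hinj : Function.Injective (algebraMap D A)) (n : ℕ)
    (a : Fin n → A) :
    ∃ d, ∃ b : Fin d → A,
      AlgebraicIndependent D (fun i => Polynomial.C (b i) * Polynomial.X) ∧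
      ∀ i, IsIntegral (Algebra.adjoin D (Set.range fun j => Polynomial.C (b j) * Polynomial.X))
        (Polynomial.C (a i) * Polynomial.X) := by
  induction n with
  | zero =>
    refine ⟨0, a, ?_, fun i => i.elim0⟩
    rw [algebraicIndependent_empty_type_iff]
    exact Polynomial.C_injective.comp hinj
  | succ n ih =>
    by_cases hind : AlgebraicIndependent D (fun i => Polynomial.C (a i) * Polynomial.X)
    · refine ⟨n + 1, a, hind, fun i => ?_⟩
      exact isIntegral_algebraMap
        (x := (⟨_, Algebra.subset_adjoin ⟨i, rfl⟩⟩ : Algebra.adjoin D (Set.range _)))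
    obtain ⟨G, hG, hG0⟩ : ∃ G : MvPolynomial (Fin (n + 1)) D,
        aeval (fun i => Polynomial.C (a i) * Polynomial.X) G = 0 ∧ G ≠ 0 := by
      rw [algebraicIndependent_iff] at hind
      push Not at hind
      exact hind
    obtain ⟨q, hq⟩ := exists_homogeneousComponent_ne_zero hG0
    have hGq := aeval_homogeneousComponent_eq_zero hG q
    let I : Submodule D (MvPolynomial (Fin (n + 1)) D) :=
      homogeneousSubmodule (Fin (n + 1)) D q ⊓ LinearMap.ker (aeval a).toLinearMap
    obtain ⟨t, φ, ⟨hφq, hφ⟩, ht⟩ := h.exists_eval_eq_one (q := q) I (fun φ hφ => hφ.1) (by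
      intro m hm
      obtain ⟨s, hs, c, hc, g, hg, e⟩ := h.exists_content m hm _ hq
      refine ⟨g, ⟨fun α hα => ?_, ?_⟩, hg⟩
      · refine homogeneousComponent_isHomogeneous q G (d := α) fun H => ?_
        have := congrArg (coeff α) e
        rw [coeff_C_mul, coeff_C_mul, H, mul_zero] at this
        exact mul_ne_zero hc hα this.symm
      · have := congrArg (aeval a) e
        rw [map_mul, map_mul, hGq, mul_zero, aeval_C] at this
        exact (mul_eq_zero.1 this.symm).resolve_left
          ((map_ne_zero_iff _ hinj).2 hc))
    replace hφ : aeval a φ = 0 := hφ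
    let a' : Fin n → A := fun i => a i.succ - algebraMap D A (t i) * a 0
    have hsucc (i : Fin n) : (Polynomial.C (a i.succ) * Polynomial.X : Polynomial A) =
        Polynomial.C (a' i) * Polynomial.X + t i • (Polynomial.C (a 0) * Polynomial.X) := by
      simp only [a', Algebra.smul_def, map_sub, map_mul, Polynomial.algebraMap_apply]
      ring
    let S := Algebra.adjoin D (Set.range fun j => Polynomial.C (a' j) * Polynomial.X)
    let p : Fin (n + 1) → Polynomial S := Fin.cons Polynomial.X fun i =>
      Polynomial.C ⟨Polynomial.C (a' i) * Polynomial.X, Algebra.subset_adjoin ⟨i, rfl⟩⟩ +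
        Polynomial.C (algebraMap D S (t i)) * Polynomial.X
    have hz : IsIntegral S (Polynomial.C (a 0) * Polynomial.X) := by
      have hp : ∀ i, (p i).natDegree ≤ 1 := by
        refine Fin.cases ?_ fun i => ?_
        · exact Polynomial.natDegree_X_le
        · simp only [p, Fin.cons_succ]
          compute_degree
      obtain ⟨h1, h2⟩ := IsHomogeneous.natDegree_aeval_le hφq p hp
      refine ⟨aeval p φ, ?_, ?_⟩
      · refine Polynomial.monic_of_natDegree_le_of_coeff_eq_one q h1 ?_
        have e : (fun i => (p i).coeff 1) =
            fun i => algebraMap D S ((Fin.cons 1 t : Fin (n + 1) → D) i) := by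
          funext i
          refine Fin.cases ?_ (fun i => ?_) i
          · simp [p]
          · simp [p, Polynomial.coeff_C]
        rw [h2, e]
        refine (aeval_algebraMap_apply S (Fin.cons 1 t : Fin (n + 1) → D) φ).trans ?_
        rw [aeval_eq_eval, ht, map_one]
      · let ev := (Polynomial.aeval (R := S) (Polynomial.C (a 0) * Polynomial.X :
          Polynomial A)).restrictScalars D
        have e : (fun i => ev (p i)) = fun i => Polynomial.C (a i) * Polynomial.X := by
          funext i
          refine Fin.cases ?_ (fun i => ?_) i
          · exact Polynomial.aeval_X _
          · refine Eq.trans ?_ (hsucc i).symm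
            change Polynomial.aeval (R := S) _ _ = _
            simp only [p, Fin.cons_succ, map_add, map_mul, Polynomial.aeval_C, Polynomial.aeval_X,
              Algebra.smul_def]
            rfl
        change ev (aeval p φ) = 0
        rw [comp_aeval_apply, e, IsHomogeneous.aeval_mul_right hφq (fun i => Polynomial.C (a i))]
        have := comp_aeval_apply a (Polynomial.CAlgHom (R := D) (A := A)) φ
        rw [hφ, map_zero] at this
        exact mul_eq_zero_of_left this.symm _
    obtain ⟨d, b, hb, hab⟩ := ih a'
    have hz' := hz.of_adjoin (T := Algebra.adjoin D
      (Set.range fun j => Polynomial.C (b j) * Polynomial.X)) (by rintro _ ⟨i, rfl⟩; exact hab i)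
    refine ⟨d, b, hb, Fin.cases hz' fun i => ?_⟩
    rw [hsucc]
    exact (hab i).add (hz'.smul (t i))

end DivisiblePrufer

theorem exists_isIntegral_pow_mul {R B : Type*} [CommRing R] [CommRing B] [Algebra R B]
    {x β : B} {p : Polynomial B} (hx : IsIntegral R x) (hp : p.Monic)
    (hβ : Polynomial.eval β p = 0) (hc : ∀ i, ∃ N, IsIntegral R (x ^ N * p.coeff i)) :
    ∃ k, IsIntegral R (x ^ k * β) := by
  choose N hN using hc
  let k := ∑ i ∈ Finset.range p.natDegree, N i
  refine ⟨k, ?_⟩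
  have hlift : p.scaleRoots (x ^ k) ∈ Polynomial.lifts (algebraMap (integralClosure R B) B) := by
    rw [Polynomial.lifts_iff_coeff_lifts]
    intro i
    rw [Polynomial.coeff_scaleRoots]
    suffices IsIntegral R (p.coeff i * (x ^ k) ^ (p.natDegree - i)) from ⟨⟨_, this⟩, rfl⟩
    rcases lt_trichotomy i p.natDegree with hi | rfl | hi
    · obtain ⟨e, he⟩ := Nat.exists_eq_add_of_lt hi
      obtain ⟨l, hl⟩ : ∃ l, k = N i + l := Nat.exists_eq_add_of_le
        (Finset.single_le_sum (f := N) (fun _ _ => zero_le) (Finset.mem_range.2 hi))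
      have e1 : p.coeff i * (x ^ k) ^ (p.natDegree - i) =
          (x ^ N i * p.coeff i) * (x ^ l * (x ^ k) ^ e) := by
        rw [show p.natDegree - i = e + 1 by omega, pow_succ (x ^ k) e]
        nth_rewrite 2 [hl]
        ring
      rw [e1]
      exact (hN i).mul ((hx.pow l).mul ((hx.pow k).pow e))
    · rw [Polynomial.coeff_natDegree, hp.leadingCoeff, Nat.sub_self, pow_zero, one_mul]
      exact isIntegral_one
    · rw [Polynomial.coeff_eq_zero_of_natDegree_lt hi, zero_mul]
      exact isIntegral_zero
  obtain ⟨q, hq, -, hqm⟩ := Polynomial.lifts_and_natDegree_eq_and_monic hlift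
    ((Polynomial.monic_scaleRoots_iff _).2 hp)
  refine isIntegral_trans (A := integralClosure R B) _ ⟨q, hqm, ?_⟩
  rw [← Polynomial.eval_map, hq]
  exact Polynomial.scaleRoots_eval₂_eq_zero (RingHom.id B) hβ

theorem finite_integralClosure_of_polynomial {R A Φ L : Type*} [CommRing R] [CommRing A] [Field Φ]
    [Algebra A Φ] [Algebra R (Polynomial Φ)] [Field L] [Algebra (Polynomial Φ) L]
    [IsFractionRing (Polynomial Φ) L] [Algebra R L] [IsScalarTower R (Polynomial Φ) L]
    (f : R →+* A)
    (hf : (algebraMap A Φ).comp f =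
      (Polynomial.evalRingHom 1).comp (algebraMap R (Polynomial Φ)))
    (hX : IsIntegral R (Polynomial.X : Polynomial Φ))
    (hA : ∀ a : A, ∃ N, IsIntegral R (Polynomial.X ^ N * Polynomial.C (algebraMap A Φ a)))
    [Module.Finite R (integralClosure R L)] : Module.Finite A (integralClosure A Φ) := by
  obtain ⟨s, hs⟩ := Module.Finite.fg_top (R := R) (M := integralClosure R L)
  have hlift (z : integralClosure R L) : ∃ p : Polynomial Φ,
      algebraMap (Polynomial Φ) L p = z := by
    have : IsIntegral (Polynomial Φ) (z : L) := z.2.tower_top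
    exact IsIntegrallyClosed.isIntegral_iff.1 this
  choose P hP using hlift
  have hPadd (z w) : P (z + w) = P z + P w :=
    IsFractionRing.injective (Polynomial Φ) L (by simp [hP])
  have hPsmul (r : R) (z) : P (r • z) = algebraMap R (Polynomial Φ) r * P z :=
    IsFractionRing.injective (Polynomial Φ) L (by
      simp [hP, Algebra.smul_def, ← IsScalarTower.algebraMap_apply])
  have hP0 : P 0 = 0 := IsFractionRing.injective (Polynomial Φ) L (by simp [hP])
  have hPint (z) : IsIntegral A ((P z).eval 1) := by
    have : IsIntegral R (P z) := by
      rw [← isIntegral_algebraMap_iff (IsFractionRing.injective (Polynomial Φ) L), hP]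
      exact z.2
    exact this.map_of_comp_eq f (Polynomial.evalRingHom 1) hf
  let g (z : integralClosure R L) : integralClosure A Φ := ⟨_, hPint z⟩
  classical
  refine ⟨⟨s.image g, ?_⟩⟩
  rw [eq_top_iff]
  rintro α -
  have hg (z) : g z ∈ Submodule.span A (s.image g : Set (integralClosure A Φ)) := by
    have hz : z ∈ Submodule.span R (s : Set (integralClosure R L)) := by rw [hs]; trivial
    induction hz using Submodule.span_induction with
    | mem z hz => exact Submodule.subset_span (Finset.mem_coe.2 (Finset.mem_image_of_mem g hz))
    | zero =>
      rw [show g 0 = 0 from Subtype.ext (by simp [g, hP0])]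
      exact zero_mem _
    | add z w _ _ hz hw =>
      rw [show g (z + w) = g z + g w from Subtype.ext (by simp [g, hPadd])]
      exact add_mem hz hw
    | smul r z _ hz =>
      have hr := RingHom.congr_fun hf r
      simp only [RingHom.comp_apply, Polynomial.coe_evalRingHom] at hr
      rw [show g (r • z) = f r • g z from
        Subtype.ext (by
          change (P (r • z)).eval 1 = f r • (P z).eval 1
          rw [hPsmul, Polynomial.eval_mul, Algebra.smul_def, hr])]
      exact Submodule.smul_mem _ (f r) hz
  obtain ⟨p, hp, hp0⟩ := α.2
  obtain ⟨k, hk⟩ := exists_isIntegral_pow_mul (β := Polynomial.C (α : Φ)) hX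
    (hp.map ((Polynomial.C : Φ →+* Polynomial Φ).comp (algebraMap A Φ)))
    (by rw [Polynomial.eval_map, ← Polynomial.hom_eval₂, hp0, map_zero])
    (fun i => by rw [Polynomial.coeff_map]; exact hA _)
  have e : P ⟨_, hk.algebraMap (B := L)⟩ = _ := IsFractionRing.injective (Polynomial Φ) L (hP _)
  rw [show α = g ⟨_, hk.algebraMap (B := L)⟩ from Subtype.ext (by
    change _ = (P _).eval 1
    rw [e]
    simp)]
  exact hg _

theorem finiteDimensional_of_polynomial {D A Φ F L : Type*} [CommRing D] [CommRing A]
    [IsDomain A] [Algebra D A] [Field Φ] [Algebra A Φ] [IsFractionRing A Φ] [Field L]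
    [Algebra (Polynomial Φ) L] [IsFractionRing (Polynomial Φ) L] [Field F] [Algebra F L]
    {n : ℕ} {f : MvPolynomial (Fin n) D →ₐ[D] A} (hf : Function.Surjective f)
    (hD : ∀ r : D, ∃ c : F, algebraMap F L c =
      algebraMap (Polynomial Φ) L (Polynomial.C (algebraMap A Φ (algebraMap D A r))))
    (hX : IsIntegral F (algebraMap (Polynomial Φ) L Polynomial.X))
    (hi : ∀ i, IsIntegral F (algebraMap (Polynomial Φ) L
      (Polynomial.C (algebraMap A Φ (f (X i))) * Polynomial.X))) : FiniteDimensional F L := by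
  let ι := algebraMap (Polynomial Φ) L
  let S : Set L := insert (ι Polynomial.X)
    (Set.range fun i => ι (Polynomial.C (algebraMap A Φ (f (X i))) * Polynomial.X))
  let K := IntermediateField.adjoin F S
  have hX0 : ι Polynomial.X ≠ 0 :=
    (map_ne_zero_iff _ (IsFractionRing.injective (Polynomial Φ) L)).2 Polynomial.X_ne_zero
  have hXK : ι Polynomial.X ∈ K := IntermediateField.subset_adjoin _ _ (Set.mem_insert _ _)
  have hA (p : MvPolynomial (Fin n) D) : ι (Polynomial.C (algebraMap A Φ (f p))) ∈ K := by
    induction p using MvPolynomial.induction_on with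
    | C r =>
      obtain ⟨c, hc⟩ := hD r
      rw [← MvPolynomial.algebraMap_eq, AlgHom.commutes]
      exact hc ▸ K.algebraMap_mem c
    | add p q hp hq =>
      simp only [map_add]
      exact K.add_mem hp hq
    | mul_X p i hp =>
      have h1 : ι (Polynomial.C (algebraMap A Φ (f (X i)))) ∈ K := by
        rw [← mul_div_cancel_right₀ (ι (Polynomial.C (algebraMap A Φ (f (X i))))) hX0, ← map_mul]
        exact K.div_mem (IntermediateField.subset_adjoin _ _ (Set.mem_insert_of_mem _ ⟨i, rfl⟩)) hXK
      simp only [map_mul]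
      exact K.mul_mem hp h1
  have hΦ (c : Φ) : ι (Polynomial.C c) ∈ K := by
    obtain ⟨a, b, hb, rfl⟩ := IsFractionRing.div_surjective (A := A) c
    obtain ⟨p, rfl⟩ := hf a
    obtain ⟨q, rfl⟩ := hf b
    have e : Polynomial.C (algebraMap A Φ (f p) / algebraMap A Φ (f q)) *
        Polynomial.C (algebraMap A Φ (f q)) = Polynomial.C (algebraMap A Φ (f p)) := by
      rw [← map_mul, div_mul_cancel₀]
      exact (map_ne_zero_iff _ (IsFractionRing.injective A Φ)).2 (nonZeroDivisors.ne_zero hb)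
    have e0 : ι (Polynomial.C (algebraMap A Φ (f q))) ≠ 0 :=
      (map_ne_zero_iff _ (IsFractionRing.injective (Polynomial Φ) L)).2 <|
        Polynomial.C_ne_zero.2 <|
          (map_ne_zero_iff _ (IsFractionRing.injective A Φ)).2 (nonZeroDivisors.ne_zero hb)
    rw [← mul_div_cancel_right₀ (ι _) e0, ← map_mul, e]
    exact K.div_mem (hA p) (hA q)
  have hP (p : Polynomial Φ) : ι p ∈ K := by
    induction p using Polynomial.induction_on' with
    | add p q hp hq => simpa only [map_add] using K.add_mem hp hq
    | monomial k c =>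
      rw [← Polynomial.C_mul_X_pow_eq_monomial, map_mul, map_pow]
      exact K.mul_mem (hΦ c) (pow_mem hXK k)
  have hK : K = ⊤ := by
    rw [eq_top_iff]
    rintro z -
    obtain ⟨p, q, hq, rfl⟩ := IsFractionRing.div_surjective (A := Polynomial Φ) z
    exact K.div_mem (hP p) (hP q)
  have : FiniteDimensional F K := by
    have : Finite S := ((Set.finite_range _).insert _).to_subtype
    refine IntermediateField.finiteDimensional_adjoin ?_
    rintro _ (rfl | ⟨i, rfl⟩)
    exacts [hX, hi i]
  rw [hK] at this
  exact IntermediateField.topEquiv.toLinearEquiv.finiteDimensional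

namespace DivisiblePrufer

variable {D : Type*} [CommRing D] [IsDomain D] {y : D}

theorem finite_integralClosure_fractionRing (h : DivisiblePrufer D y) [Algebra ℚ D] {A : Type*}
    [CommRing A] [IsDomain A] [Algebra D A] [hft : Algebra.FiniteType D A]
    (hinj : Function.Injective (algebraMap D A)) :
    Module.Finite A (integralClosure A (FractionRing A)) := by
  obtain ⟨n, f, hf⟩ := Algebra.FiniteType.iff_quotient_mvPolynomial''.1 hft
  obtain ⟨d, b, hb, hint⟩ := h.exists_noether_normalization hinj (n + 1)
    (Fin.cons 1 fun i => f (X i))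
  let R := MvPolynomial (Fin d) D
  let Φ := FractionRing A
  let θ : R →ₐ[D] Polynomial A := aeval fun i => Polynomial.C (b i) * Polynomial.X
  have hθ : Function.Injective θ := hb
  let _ : Algebra R (Polynomial Φ) :=
    ((Polynomial.mapRingHom (algebraMap A Φ)).comp θ.toRingHom).toAlgebra
  have hΦ : Function.Injective (algebraMap R (Polynomial Φ)) :=
    (Polynomial.map_injective _ (IsFractionRing.injective A Φ)).comp hθ
  let L := FractionRing (Polynomial Φ)
  have hint' (i) := (hint i).map_of_comp_eq (S := Polynomial A) (U := Polynomial Φ)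
    hb.aevalEquiv.symm.toRingHom (Polynomial.mapRingHom (algebraMap A Φ)) (by
      ext1 x
      obtain ⟨p, rfl⟩ := hb.aevalEquiv.surjective x
      change Polynomial.mapRingHom _ (θ (hb.aevalEquiv.symm (hb.aevalEquiv p))) =
        Polynomial.mapRingHom _ (algebraMap _ _ (hb.aevalEquiv p))
      rw [AlgEquiv.symm_apply_apply, hb.algebraMap_aevalEquiv])
  have hX : IsIntegral R (Polynomial.X : Polynomial Φ) := by simpa using hint' 0
  have hi (i) : IsIntegral R (Polynomial.C (algebraMap A Φ (f (X i))) * Polynomial.X) := by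
    simpa using hint' (Fin.succ i)
  have hC (r : D) : algebraMap R (Polynomial Φ) (C r) =
      Polynomial.C (algebraMap A Φ (algebraMap D A r)) := by
    change Polynomial.mapRingHom _ (θ (C r)) = _
    have e : θ (C r) = algebraMap D _ r := θ.commutes r
    rw [e, Polynomial.algebraMap_apply]
    exact Polynomial.map_C _
  have hA (p) : ∃ N, IsIntegral R
      (Polynomial.X ^ N * Polynomial.C (algebraMap A Φ (f p))) := by
    induction p using MvPolynomial.induction_on with
    | C r =>
      refine ⟨0, ?_⟩
      rw [pow_zero, one_mul, ← MvPolynomial.algebraMap_eq, AlgHom.commutes, ← hC]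
      exact isIntegral_algebraMap
    | add p q hp hq =>
      obtain ⟨N, hN⟩ := hp
      obtain ⟨M, hM⟩ := hq
      refine ⟨N + M, ?_⟩
      convert! ((hX.pow M).mul hN).add ((hX.pow N).mul hM) using 1
      simp only [map_add]
      ring
    | mul_X p i hp =>
      obtain ⟨N, hN⟩ := hp
      refine ⟨N + 1, ?_⟩
      convert! hN.mul (hi i) using 1
      simp only [map_mul]
      ring
  have hL : Function.Injective (algebraMap R L) := by
    rw [IsScalarTower.algebraMap_eq R (Polynomial Φ) L]
    exact (IsFractionRing.injective (Polynomial Φ) L).comp hΦ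
  have : FaithfulSMul R L := (faithfulSMul_iff_algebraMap_injective R L).2 hL
  let F := FractionRing R
  let _ : Algebra F L := FractionRing.liftAlgebra R L
  have : IsScalarTower R F L := FractionRing.isScalarTower_liftAlgebra R L
  have : FiniteDimensional F L := finiteDimensional_of_polynomial (Φ := Φ) hf
    (fun r => ⟨algebraMap R F (C r), by
      rw [← hC, ← IsScalarTower.algebraMap_apply, ← IsScalarTower.algebraMap_apply]⟩)
    (hX.algebraMap (B := L)).tower_top fun i => ((hi i).algebraMap (B := L)).tower_top
  have : Module.Finite R (integralClosure R L) := h.finite_integralClosure F L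
  refine finite_integralClosure_of_polynomial (L := L)
    ((Polynomial.evalRingHom 1).comp θ.toRingHom) (RingHom.ext fun r => ?_) hX fun a => ?_
  · change algebraMap A Φ ((θ r).eval 1) = ((θ r).map (algebraMap A Φ)).eval 1
    rw [Polynomial.eval_one_map]
  · obtain ⟨p, rfl⟩ := hf a
    exact hA p

end DivisiblePrufer

theorem DivisiblePrufer.universallyJapanese {D : Type u} [CommRing D] [Algebra ℚ D] {y : D}
    (h : DivisiblePrufer D y) : UniversallyJapanese D := by
  intro A _ _ _ hA
  let P := RingHom.ker (algebraMap D A)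
  have : P.IsPrime := RingHom.ker_isPrime _
  let _ : Algebra (D ⧸ P) A := (RingHom.kerLift (algebraMap D A)).toAlgebra
  have : IsScalarTower D (D ⧸ P) A := IsScalarTower.of_algebraMap_eq fun _ => rfl
  have : Algebra.FiniteType (D ⧸ P) A := Algebra.FiniteType.of_restrictScalars_finiteType D _ A
  exact (h.quotient P).finite_integralClosure_fractionRing (RingHom.kerLift_injective _)

theorem ValuationRing.exists_forall_dvd {V ι : Type*} [CommRing V] [IsDomain V] [ValuationRing V]
    [Finite ι] [Nonempty ι] (c : ι → V) : ∃ i, ∀ j, c i ∣ c j := by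
  classical
  cases nonempty_fintype ι
  suffices H : ∀ s : Finset ι, s.Nonempty → ∃ i, ∀ j ∈ s, c i ∣ c j by
    obtain ⟨i, hi⟩ := H Finset.univ Finset.univ_nonempty
    exact ⟨i, fun j => hi j (Finset.mem_univ j)⟩
  intro s hs
  induction hs using Finset.Nonempty.cons_induction with
  | singleton i => exact ⟨i, by simp⟩
  | cons k s hk hs ih =>
    obtain ⟨i, hi⟩ := ih
    rcases ValuationRing.dvd_total (c i) (c k) with h | h
    · exact ⟨i, by simpa [h] using hi⟩
    · exact ⟨k, by simpa using fun j hj => h.trans (hi j hj)⟩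

theorem IsN2.exists_eq_mul_pow {V : Type u} [CommRing V] [IsDomain V] [ValuationRing V]
    (hV : IsN2 V) {y : V} (hy : Ideal.span {y} = IsLocalRing.maximalIdeal V) {a : V} (ha : a ≠ 0)
    {n : ℕ} (hn : 0 < n) : ∃ u : V, IsUnit u ∧ ∃ j b, a = u * (y ^ j * b ^ n) := by
  let K := FractionRing V
  obtain ⟨α, hα⟩ := IsAlgClosed.exists_pow_nat_eq (algebraMap V (AlgebraicClosure K) a) hn
  have hint : IsIntegral K α :=
    IsIntegral.of_pow hn (hα ▸ (isIntegral_algebraMap (R := V)).tower_top)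
  let L := IntermediateField.adjoin K {α}
  have : FiniteDimensional K L := IntermediateField.adjoin.finiteDimensional hint
  let B := integralClosure V L
  have : Module.Finite V B := hV L inferInstance
  have hVL : Function.Injective (algebraMap V L) := by
    rw [IsScalarTower.algebraMap_eq V K L]
    exact (algebraMap K L).injective.comp (IsFractionRing.injective V K)
  have hVB : Function.Injective (algebraMap V B) := fun r s hrs => hVL (congrArg Subtype.val hrs)
  have : Module.IsTorsionFree V B := Module.isTorsionFree_iff_algebraMap_injective.2 hVB
  have : Module.Flat V B := by
    rwa [Module.Flat.flat_iff_torsion_eq_bot_of_isBezout,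
      ← Submodule.isTorsionFree_iff_torsion_eq_bot]
  have : Module.Free V B := Module.free_of_flat_of_isLocalRing
  let v := Module.Free.chooseBasis V B
  obtain ⟨x, hx⟩ : ∃ x : B, x ^ n = algebraMap V B a := by
    let β : L := IntermediateField.AdjoinSimple.gen K α
    have hβ : β ^ n = algebraMap V L a := Subtype.ext (by
      simp [β]
      exact hα)
    exact ⟨⟨β, IsIntegral.of_pow hn (hβ ▸ isIntegral_algebraMap)⟩, Subtype.ext hβ⟩
  have hx0 : x ≠ 0 := by
    rintro rfl
    rw [zero_pow hn.ne', eq_comm, map_eq_zero_iff _ hVB] at hx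
    exact ha hx
  have : Nonempty (Module.Free.ChooseBasisIndex V B) := by
    by_contra H
    rw [not_nonempty_iff] at H
    exact hx0 (v.ext_elem fun i => H.elim i)
  obtain ⟨i, hi⟩ := ValuationRing.exists_forall_dvd fun i => v.repr x i
  choose d hd using hi
  let c := v.repr x i
  have hc : c ≠ 0 := fun hc => hx0 (v.ext_elem fun j => by rw [hd]; simp [c, hc])
  obtain ⟨z, hz⟩ : ∃ z : B, x = c • z := ⟨v.equivFun.symm d, v.ext_elem fun j => by
    rw [hd, map_smul, Finsupp.smul_apply, ← v.equivFun_apply (v.equivFun.symm d),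
      LinearEquiv.apply_symm_apply, smul_eq_mul]⟩
  have hy1 : ¬ IsUnit y := by
    rw [← mem_nonunits_iff, ← IsLocalRing.mem_maximalIdeal, ← hy]
    exact Ideal.mem_span_singleton_self y
  have hyz (z' : B) : z ≠ y • z' := by
    rintro rfl
    have e : c * 1 = c * (y * v.repr z' i) := by
      conv_lhs => rw [mul_one]; unfold c; rw [hz]
      simp only [map_smul, Finsupp.smul_apply, smul_eq_mul]
    exact hy1 (IsUnit.of_mul_eq_one _ (mul_left_cancel₀ hc e).symm)
  have hzn : algebraMap V L (c ^ n) * (z : L) ^ n = algebraMap V L a := by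
    have := congrArg Subtype.val hx
    rw [hz, smul_pow, Algebra.smul_def] at this
    exact this
  obtain ⟨w, hw⟩ : ∃ w, algebraMap V L w = (z : L) ^ n := by
    have e : algebraMap K L (algebraMap V K a / algebraMap V K (c ^ n)) = (z : L) ^ n := by
      rw [map_div₀, ← IsScalarTower.algebraMap_apply, ← IsScalarTower.algebraMap_apply,
        div_eq_iff ((map_ne_zero_iff _ hVL).2 (pow_ne_zero n hc)), mul_comm, hzn]
    have hK : IsIntegral V (algebraMap V K a / algebraMap V K (c ^ n)) := by
      rw [← isIntegral_algebraMap_iff (algebraMap K L).injective, e]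
      exact z.2.pow n
    obtain ⟨w, hw⟩ := IsIntegrallyClosed.isIntegral_iff.1 hK
    exact ⟨w, by rw [← e, ← hw, ← IsScalarTower.algebraMap_apply]⟩
  have haw : a = c ^ n * w := hVL (by rw [map_mul, hw, hzn])
  have hdvd : ¬ y ^ n ∣ w := by
    rintro ⟨r, rfl⟩
    have hy0 : y ≠ 0 := by
      rintro rfl
      exact ha (by rw [haw, zero_pow hn.ne', zero_mul, mul_zero])
    have hy0' : algebraMap V L y ≠ 0 := (map_ne_zero_iff _ hVL).2 hy0
    have e : ((z : L) / algebraMap V L y) ^ n = algebraMap V L r := by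
      rw [div_pow, ← hw, map_mul, map_pow, mul_div_cancel_left₀ _ (pow_ne_zero n hy0')]
    refine hyz ⟨_, IsIntegral.of_pow hn (e ▸ isIntegral_algebraMap)⟩ (Subtype.ext ?_)
    change (z : L) = y • _
    rw [Algebra.smul_def, mul_div_cancel₀ _ hy0']
  obtain ⟨u, hu, hyu⟩ := FiniteMultiplicity.exists_eq_pow_mul_and_not_dvd (a := y) (b := w)
    ⟨n - 1, by rwa [Nat.sub_add_cancel hn]⟩
  generalize multiplicity y w = j at hu
  refine ⟨u, ?_, j, c, by rw [haw, hu]; ring⟩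
  by_contra H
  rw [← mem_nonunits_iff, ← IsLocalRing.mem_maximalIdeal, ← hy, Ideal.mem_span_singleton] at H
  exact hyu H

theorem IsPruferDomain.divisiblePrufer {D : Type u} [CommRing D] [IsDomain D]
    (hD : IsPruferDomain D) {y : D}
    (hy : ∀ (𝔪 : Ideal D) [𝔪.IsMaximal],
      Ideal.span {algebraMap D (Localization.AtPrime 𝔪) y} =
        IsLocalRing.maximalIdeal (Localization.AtPrime 𝔪))
    (hN : ∀ (𝔪 : Ideal D) [𝔪.IsMaximal], IsN2 (Localization.AtPrime 𝔪)) :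
    DivisiblePrufer D y := by
  have inj (m : Ideal D) [m.IsPrime] : Function.Injective (algebraMap D (Localization.AtPrime m)) :=
    IsLocalization.injective _ m.primeCompl_le_nonZeroDivisors
  have hdvd (m : Ideal D) [m.IsPrime] {a b : D}
      (hab : algebraMap D (Localization.AtPrime m) a ∣ algebraMap D _ b) :
      ∃ s ∉ m, a ∣ s * b := by
    obtain ⟨c, hc⟩ := hab
    obtain ⟨⟨d, s⟩, hs⟩ := IsLocalization.surj m.primeCompl c
    refine ⟨s, s.2, d, inj m ?_⟩
    simp only at hs
    rw [map_mul, map_mul, hc, ← hs]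
    ring
  constructor
  · intro m hm a b
    have := hD m
    rcases ValuationRing.dvd_total (algebraMap D (Localization.AtPrime m) a)
      (algebraMap D _ b) with h | h
    · obtain ⟨s, hs, h⟩ := hdvd m h
      exact ⟨s, hs, Or.inl h⟩
    · obtain ⟨s, hs, h⟩ := hdvd m h
      exact ⟨s, hs, Or.inr h⟩
  · intro m hm
    rw [← IsLocalization.AtPrime.to_map_mem_maximal_iff (Localization.AtPrime m) m, ← hy m]
    exact Ideal.mem_span_singleton_self _
  · intro m hm a ha
    rw [← IsLocalization.AtPrime.to_map_mem_maximal_iff (Localization.AtPrime m) m, ← hy m,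
      Ideal.mem_span_singleton] at ha
    exact hdvd m ha
  · intro m hm a ha n hn
    have := hD m
    obtain ⟨u, hu, j, b, e⟩ := (hN m).exists_eq_mul_pow (hy m)
      ((map_ne_zero_iff _ (inj m)).2 ha) hn
    obtain ⟨⟨t, s⟩, hs⟩ := IsLocalization.surj m.primeCompl u
    obtain ⟨⟨c, r⟩, hr⟩ := IsLocalization.surj m.primeCompl b
    simp only at hs hr
    refine ⟨s * r ^ n, (s * r ^ n).2, t, ?_, j, c, inj m ?_⟩
    · rw [← IsLocalization.AtPrime.to_map_mem_maximal_iff (Localization.AtPrime m) m, ← hs,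
        IsLocalRing.mem_maximalIdeal, mem_nonunits_iff, not_not]
      exact hu.mul (IsLocalization.map_units _ s)
    · simp only [map_mul, map_pow, e, ← hs, ← hr]
      ring

theorem UniversallyJapanese.finite_integralClosure {D : Type u} [CommRing D] [IsDomain D]
    (hD : UniversallyJapanese D) (L : Type u) [Field L] [Algebra D L] (K : Type u) [Field K]
    [Algebra D K] [IsFractionRing D K] [Algebra K L] [IsScalarTower D K L] [FiniteDimensional K L] :
    Module.Finite D (integralClosure D L) := by
  classical
  have hinj : Function.Injective (algebraMap D L) := by
    rw [IsScalarTower.algebraMap_eq D K L]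
    exact (algebraMap K L).injective.comp (IsFractionRing.injective D K)
  have halg : Algebra.IsAlgebraic D L := by
    rw [IsFractionRing.comap_isAlgebraic_iff (K := K)]
    infer_instance
  let v := Module.finBasis K L
  choose c hc hcv using fun i => (halg.isAlgebraic (v i)).exists_integral_multiple
  let A := Algebra.adjoin D (Set.range fun i => c i • v i)
  have hfin : Module.Finite D A := Module.Finite.iff_fg.2
    (fg_adjoin_of_finite (Set.finite_range _) (by rintro _ ⟨i, rfl⟩; exact hcv i))
  have key (z : L) : ∃ d : D, d ≠ 0 ∧ d • z ∈ A := by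
    have hz : z ∈ Submodule.span K (Set.range v) := by rw [v.span_eq]; trivial
    induction hz using Submodule.span_induction with
    | mem z hz =>
      obtain ⟨i, rfl⟩ := hz
      exact ⟨c i, hc i, Algebra.subset_adjoin ⟨i, rfl⟩⟩
    | zero => exact ⟨1, one_ne_zero, by rw [smul_zero]; exact zero_mem A⟩
    | add z w _ _ hz hw =>
      obtain ⟨d, hd, hz⟩ := hz
      obtain ⟨e, he, hw⟩ := hw
      refine ⟨d * e, mul_ne_zero hd he, ?_⟩
      have e' : (d * e) • (z + w) = e • d • z + d • e • w := by
        simp only [Algebra.smul_def, map_mul]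
        ring
      rw [e']
      exact add_mem (A.smul_mem hz e) (A.smul_mem hw d)
    | smul k z _ hz =>
      obtain ⟨d, hd, hz⟩ := hz
      obtain ⟨a, b, hb, rfl⟩ := IsFractionRing.div_surjective (A := D) k
      have hb0 := nonZeroDivisors.ne_zero hb
      refine ⟨b * d, mul_ne_zero hb0 hd, ?_⟩
      have e : (b * d) • (algebraMap D K a / algebraMap D K b) • z = a • d • z := by
        have hb' : algebraMap D L b ≠ 0 := (map_ne_zero_iff _ hinj).2 hb0
        simp only [Algebra.smul_def, map_div₀, ← IsScalarTower.algebraMap_apply, map_mul]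
        field_simp
      rw [e]
      exact A.smul_mem hz a
  have : IsFractionRing A L := IsFractionRing.of_field A L fun z => by
    obtain ⟨d, hd, hz⟩ := key z
    refine ⟨⟨_, hz⟩, algebraMap D A d, ?_⟩
    change z = (d • z) / algebraMap D L d
    rw [Algebra.smul_def, mul_div_cancel_left₀ _ ((map_ne_zero_iff _ hinj).2 hd)]
  have hN : Module.Finite A (integralClosure A (FractionRing A)) := hD A inferInstance
  have : Module.Finite A (integralClosure A L) :=
    Module.Finite.equiv (FractionRing.algEquiv A L).mapIntegralClosure.toLinearEquiv
  have : Module.Finite D (integralClosure A L) := Module.Finite.trans A _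
  have : Algebra.IsIntegral D A := inferInstance
  let f : integralClosure A L →ₗ[D] integralClosure D L :=
    { toFun := fun z => ⟨z, isIntegral_trans (R := D) (A := A) (z : L) z.2⟩
      map_add' := fun _ _ => rfl
      map_smul' := fun _ _ => rfl }
  exact Module.Finite.of_surjective f fun z => ⟨⟨z, z.2.tower_top⟩, rfl⟩

theorem finite_integralClosure_localization {D V L : Type*} [CommRing D] [CommRing V] [CommRing L]
    [Algebra D V] [Algebra V L] [Algebra D L] [IsScalarTower D V L] (M : Submonoid D)
    [IsLocalization M V] [Module.Finite D (integralClosure D L)] :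
    Module.Finite V (integralClosure V L) := by
  classical
  obtain ⟨s, hs⟩ := Module.Finite.fg_top (R := D) (M := integralClosure D L)
  let g (z : integralClosure D L) : integralClosure V L := ⟨z, z.2.tower_top⟩
  have hg (z : integralClosure D L) : g z ∈ Submodule.span V (g '' s) := by
    have hz : z ∈ Submodule.span D (s : Set (integralClosure D L)) := by rw [hs]; trivial
    induction hz using Submodule.span_induction with
    | mem z hz => exact Submodule.subset_span ⟨z, hz, rfl⟩
    | zero => exact zero_mem _
    | add z w _ _ hz hw => exact add_mem hz hw
    | smul d z _ hz =>
      have e : g (d • z) = algebraMap D V d • g z :=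
        Subtype.ext (algebraMap_smul V d (z : L)).symm
      rw [e]
      exact Submodule.smul_mem _ _ hz
  refine ⟨(Submodule.fg_def.2 ⟨g '' s, s.finite_toSet.image g, eq_top_iff.2 fun z _ => ?_⟩)⟩
  obtain ⟨m, hm⟩ := IsIntegral.exists_multiple_integral_of_isLocalization M (z : L) z.2
  obtain ⟨u, hu⟩ := IsLocalization.map_units V m
  have e : z = (↑u⁻¹ : V) • g ⟨m • (z : L), hm⟩ := by
    refine Subtype.ext ?_
    change (z : L) = (↑u⁻¹ : V) • (m : D) • (z : L)
    rw [← algebraMap_smul V (m : D) (z : L), ← hu, smul_smul, Units.inv_mul, one_smul]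
  rw [e]
  exact Submodule.smul_mem _ _ (hg _)

theorem isFractionRing_of_isLocalization {D V K : Type*} [CommRing D] [IsDomain D] [CommRing V]
    [Field K] [Algebra D V] [Algebra V K] [Algebra D K] [IsScalarTower D V K] [IsFractionRing V K]
    (M : Submonoid D) (hM : M ≤ nonZeroDivisors D) [IsLocalization M V] : IsFractionRing D K := by
  have hinj : Function.Injective (algebraMap D K) := by
    rw [IsScalarTower.algebraMap_eq D V K]
    exact (IsFractionRing.injective V K).comp (IsLocalization.injective V hM)
  have : FaithfulSMul D K := (faithfulSMul_iff_algebraMap_injective D K).2 hinj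
  refine IsFractionRing.of_field D K fun k => ?_
  obtain ⟨v, w, hw, rfl⟩ := IsFractionRing.div_surjective (A := V) k
  obtain ⟨⟨a, s⟩, hs⟩ := IsLocalization.surj M v
  obtain ⟨⟨b, t⟩, ht⟩ := IsLocalization.surj M w
  refine ⟨a * t, b * s, ?_⟩
  have hw0 : algebraMap V K w ≠ 0 := by
    have : Nontrivial V := (algebraMap V K).domain_nontrivial
    exact IsFractionRing.to_map_ne_zero_of_mem_nonZeroDivisors hw
  have hne (r : M) : algebraMap D K r ≠ 0 :=
    (map_ne_zero_iff _ hinj).2 (nonZeroDivisors.ne_zero (hM r.2))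
  replace hs := congrArg (algebraMap V K) hs
  replace ht := congrArg (algebraMap V K) ht
  simp only [map_mul, ← IsScalarTower.algebraMap_apply] at hs ht
  have hs' := hne s
  have ht' := hne t
  rw [map_mul, map_mul, ← hs, ← ht]
  field_simp

theorem UniversallyJapanese.finite_integralClosure_of_isLocalization {D V K L : Type u}
    [CommRing D] [IsDomain D] (hD : UniversallyJapanese D) [CommRing V] [Field K] [Field L]
    [Algebra D V] [Algebra V K] [Algebra V L] [Algebra K L] [IsScalarTower V K L]
    [IsFractionRing V K] [FiniteDimensional K L] (M : Submonoid D)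
    (hM : M ≤ nonZeroDivisors D) [IsLocalization M V] : Module.Finite V (integralClosure V L) := by
  let _ : Algebra D L := ((algebraMap V L).comp (algebraMap D V)).toAlgebra
  let _ : Algebra D K := ((algebraMap V K).comp (algebraMap D V)).toAlgebra
  have : IsScalarTower D V L := .of_algebraMap_eq fun _ => rfl
  have : IsScalarTower D V K := .of_algebraMap_eq fun _ => rfl
  have : IsScalarTower D K L := .of_algebraMap_eq fun x =>
    IsScalarTower.algebraMap_apply V K L (algebraMap D V x)
  have : IsFractionRing D K := isFractionRing_of_isLocalization (V := V) M hM
  have := hD.finite_integralClosure L K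
  exact finite_integralClosure_localization M

theorem UniversallyJapanese.isN2_of_isLocalization {D V : Type u} [CommRing D] [IsDomain D]
    (hD : UniversallyJapanese D) [CommRing V] [IsDomain V] [Algebra D V] (M : Submonoid D)
    (hM : M ≤ nonZeroDivisors D) [IsLocalization M V] : IsN2 V :=
  fun _ _ _ _ _ _ => hD.finite_integralClosure_of_isLocalization (K := FractionRing V) M hM

/-- Let `D` be a Prüfer domain containing `ℚ`, and suppose some `y ∈ D`
generates the maximal ideal of `D_𝔪` for every maximal ideal `𝔪` of `D`.
Then `D` is universally Japanese if and only if `D_𝔪` is N-2 for every maximal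
ideal `𝔪` of `D`. -/
theorem prufer_universallyJapanese_iff_localizations_isN2
    (D : Type u) [CommRing D] [IsDomain D] [Algebra ℚ D] (hD : IsPruferDomain D)
    (y : D)
    (hy : ∀ (𝔪 : Ideal D) [𝔪.IsMaximal],
      Ideal.span {algebraMap D (Localization.AtPrime 𝔪) y} =
        IsLocalRing.maximalIdeal (Localization.AtPrime 𝔪)) :
    UniversallyJapanese D ↔
      ∀ (𝔪 : Ideal D) [𝔪.IsMaximal], IsN2 (Localization.AtPrime 𝔪) :=
  ⟨fun h 𝔪 _ => h.isN2_of_isLocalization 𝔪.primeCompl 𝔪.primeCompl_le_nonZeroDivisors,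
    fun h => (hD.divisiblePrufer hy h).universallyJapanese⟩
end

section
/- Let V be a valuation ring with fraction field K, and let Γ = K^×/V^× be its value group, a linearly ordered abelian group (written multiplicatively, ordered by divisibility in V). Assume that Γ has a smallest element ε greater than the identity, and that the quotient group Γ/⟨ε⟩ is not divisible (i.e., there exist γ ∈ Γ and a prime number p such that γ does not lie in the subgroup generated by p-th powers of Γ together with ε). Then V is not N-2. -/
set_option synthInstance.maxHeartbeats 400000
set_option maxHeartbeats 800000

universe u

/-- The subgroup of `K^×` (for `K` the fraction field of `V`) consisting of the
units of `V`. -/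
noncomputable def unitImage (V : Type u) [CommRing V] [IsDomain V] :
    Subgroup (FractionRing V)ˣ :=
  (Units.map (algebraMap V (FractionRing V)).toMonoidHom).range

/-- The value group `Γ = K^×/V^×` of a valuation ring `V` with fraction field
`K`. -/
abbrev ValueGrp (V : Type u) [CommRing V] [IsDomain V] : Type u :=
  (FractionRing V)ˣ ⧸ unitImage V

/-- The order on the value group `Γ = K^×/V^×`: the class of `a` is `≤` the
class of `b` exactly when `b/a ∈ V`. -/
def vle (V : Type u) [CommRing V] [IsDomain V] (x y : ValueGrp V) : Prop :=
  ∃ a b : (FractionRing V)ˣ, (a : ValueGrp V) = x ∧ (b : ValueGrp V) = y ∧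
    ∃ v : V, algebraMap V (FractionRing V) v = ((b * a⁻¹ : (FractionRing V)ˣ) : FractionRing V)

theorem vle_mk_iff {V : Type u} [CommRing V] [IsDomain V] (x y : (FractionRing V)ˣ) :
    vle V (x : ValueGrp V) (y : ValueGrp V) ↔
      ∃ v : V, algebraMap V (FractionRing V) v = ((y * x⁻¹ : (FractionRing V)ˣ) : FractionRing V) := by
  refine ⟨?_, fun h ↦ ⟨x, y, rfl, rfl, h⟩⟩
  rintro ⟨a, b, ha, hb, v, hv⟩
  obtain ⟨r, hr⟩ := QuotientGroup.eq.mp ha.symm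
  obtain ⟨s, hs⟩ := QuotientGroup.eq.mp hb
  refine ⟨v * r * s, ?_⟩
  have hr' : algebraMap V (FractionRing V) r = ((x⁻¹ * a : (FractionRing V)ˣ) : FractionRing V) :=
    congrArg Units.val hr
  have hs' : algebraMap V (FractionRing V) s = ((b⁻¹ * y : (FractionRing V)ˣ) : FractionRing V) :=
    congrArg Units.val hs
  rw [map_mul, map_mul, hv, hr', hs', ← Units.val_mul, ← Units.val_mul]
  congr 1
  calc b * a⁻¹ * (x⁻¹ * a) * (b⁻¹ * y) = (b * b⁻¹) * (a * a⁻¹) * (y * x⁻¹) := by ac_rfl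
    _ = y * x⁻¹ := by simp

theorem mk_eq_one_of_mem_range {V : Type u} [CommRing V] [IsDomain V] {x : (FractionRing V)ˣ}
    (hx : (x : FractionRing V) ∈ (algebraMap V (FractionRing V)).range)
    (hx' : ((x⁻¹ : (FractionRing V)ˣ) : FractionRing V) ∈ (algebraMap V (FractionRing V)).range) :
    (x : ValueGrp V) = 1 := by
  obtain ⟨v, hv⟩ := hx
  obtain ⟨w, hw⟩ := hx'
  have h : v * w = 1 := by
    apply IsFractionRing.injective V (FractionRing V)
    rw [map_mul, hv, hw, ← Units.val_mul, mul_inv_cancel, Units.val_one, map_one]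
  exact (QuotientGroup.eq_one_iff x).mpr ⟨Units.mkOfMulEqOne v w h, Units.ext hv⟩

/-- If `ε` is the smallest value above the identity, an element whose value lies between `1` and
a power of `ε` has value in the subgroup generated by `ε`. -/
theorem mk_mem_zpowers_of_dvd_pow {V : Type u} [CommRing V] [IsDomain V] (t : (FractionRing V)ˣ)
    (hmin : ∀ δ : ValueGrp V, (vle V 1 δ ∧ δ ≠ 1) → vle V (t : ValueGrp V) δ) (n : ℕ)
    (x : (FractionRing V)ˣ) (hx : (x : FractionRing V) ∈ (algebraMap V (FractionRing V)).range)
    (hxt : ((t ^ n * x⁻¹ : (FractionRing V)ˣ) : FractionRing V) ∈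
      (algebraMap V (FractionRing V)).range) :
    (x : ValueGrp V) ∈ Subgroup.zpowers (t : ValueGrp V) := by
  induction n generalizing x with
  | zero =>
    rw [mk_eq_one_of_mem_range hx (by simpa using hxt)]
    exact one_mem _
  | succ n ih =>
    by_cases h1 : (x : ValueGrp V) = 1
    · rw [h1]
      exact one_mem _
    have h := hmin x ⟨(vle_mk_iff 1 x).mpr (by simpa using hx), h1⟩
    have key := ih (x * t⁻¹) ((vle_mk_iff t x).mp h) (by
      convert hxt using 2
      rw [mul_inv, inv_inv, pow_succ, mul_assoc, mul_comm t])
    have : (x : ValueGrp V) = ((x * t⁻¹ : (FractionRing V)ˣ) : ValueGrp V) * (t : ValueGrp V) := by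
      rw [← QuotientGroup.mk_mul, inv_mul_cancel_right]
    rw [this]
    exact mul_mem key (Subgroup.mem_zpowers _)

theorem exists_pow_eq_of_mul_pow_eq {G : Type*} [CommGroup G] {a c d : G} {p i j : ℕ}
    (hp : p.Prime) (hij : i < j) (hj : j < p) (h : d ^ p * a ^ j = c ^ p * a ^ i) :
    ∃ y : G, y ^ p = a := by
  have hy : (c * d⁻¹) ^ p = a ^ (j - i) := by
    rw [pow_sub _ hij.le, mul_pow, inv_pow, mul_inv_eq_iff_eq_mul, mul_right_comm, mul_comm (a ^ j),
      h, mul_inv_cancel_right]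
  obtain ⟨u, v, huv⟩ := Nat.isCoprime_iff_coprime.mpr
    (Nat.coprime_of_lt_prime (Nat.sub_ne_zero_of_lt hij) ((Nat.sub_le j i).trans_lt hj) hp).symm
  refine ⟨(c * d⁻¹) ^ u * a ^ v, ?_⟩
  rw [mul_pow, ← zpow_natCast, ← zpow_natCast, ← zpow_mul, ← zpow_mul, mul_comm u, zpow_mul,
    zpow_natCast, hy, ← zpow_natCast, ← zpow_mul, ← zpow_add, mul_comm _ u, huv, zpow_one]

theorem ValuationRing.exists_eq_span_singleton_of_fg {V K : Type*} [CommRing V] [IsDomain V]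
    [ValuationRing V] [Field K] [Algebra V K] [IsFractionRing V K] (N : Submodule V K)
    (hN : N.FG) : ∃ c : K, N = Submodule.span V {c} := by
  refine Submodule.fg_induction (motive := fun N _ ↦ ∃ c : K, N = Submodule.span V {c})
    (fun x ↦ ⟨x, rfl⟩) ?_ N hN
  rintro _ _ - - ⟨x, rfl⟩ ⟨y, rfl⟩
  have key : ∀ x y : K, y ≠ 0 → IsLocalization.IsInteger V (x / y) →
      Submodule.span V {x} ≤ Submodule.span V {y} := by
    rintro x y hy ⟨v, hv⟩
    rw [Submodule.span_singleton_le_iff_mem, Submodule.mem_span_singleton]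
    exact ⟨v, by rw [Algebra.smul_def, hv, div_mul_cancel₀ _ hy]⟩
  rcases eq_or_ne y 0 with rfl | hy
  · exact ⟨x, by simp⟩
  rcases eq_or_ne x 0 with rfl | hx
  · exact ⟨y, by simp⟩
  rcases ValuationRing.isInteger_or_isInteger V (x / y) with h | h
  · exact ⟨y, sup_eq_right.mpr (key x y hy h)⟩
  · exact ⟨x, sup_eq_left.mpr (key y x hx (by rwa [inv_div] at h))⟩

/-- A valuation of a field extends to any larger field. -/
theorem ValuationRing.exists_valuationSubring_comap_eq {V K L : Type*} [CommRing V] [IsDomain V]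
    [ValuationRing V] [Field K] [Algebra V K] [IsFractionRing V K] [Field L] [Algebra K L] :
    ∃ W : ValuationSubring L, ∀ x : K, algebraMap K L x ∈ W ↔ x ∈ (algebraMap V K).range := by
  obtain ⟨W, hle, hloc⟩ := (LocalSubring.range
    ((algebraMap K L).comp (algebraMap V K))).exists_le_valuationSubring
  have hmem (v : V) : algebraMap K L (algebraMap V K v) ∈ W := hle ⟨v, rfl⟩
  refine ⟨W, fun x ↦ ⟨fun hx ↦ ?_, ?_⟩⟩
  · rcases ValuationRing.isInteger_or_isInteger V x with h | ⟨v, hv⟩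
    · exact h
    rcases eq_or_ne x 0 with rfl | hx0
    · exact zero_mem _
    have hunit : IsUnit (⟨algebraMap K L (algebraMap V K v), hmem v⟩ : W.toSubring) :=
      isUnit_iff_exists_inv.mpr ⟨⟨algebraMap K L x, hx⟩, Subtype.ext (by
        simp [hv, hx0])⟩
    obtain ⟨⟨_, w, rfl⟩, hw⟩ := isUnit_iff_exists_inv.mp
      (hloc.map_nonunit ⟨_, ⟨v, rfl⟩⟩ hunit)
    have hw' : algebraMap V K v * algebraMap V K w = 1 := by
      apply (algebraMap K L).injective
      simpa using congrArg Subtype.val hw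
    refine ⟨w, ?_⟩
    rw [hv] at hw'
    field_simp at hw'
    exact hw'
  · rintro ⟨v, rfl⟩
    exact hmem v

theorem Valuation.map_le_map_sum_of_pairwise_ne {L Γ₀ ι : Type*} [Ring L]
    [LinearOrderedCommGroupWithZero Γ₀] (v : Valuation L Γ₀) (s : Finset ι) (f : ι → L)
    (h : ∀ i ∈ s, ∀ j ∈ s, i ≠ j → v (f i) = v (f j) → v (f i) = 0) {i : ι} (hi : i ∈ s) :
    v (f i) ≤ v (∑ j ∈ s, f j) := by
  classical
  obtain ⟨j, hj, hmax⟩ := s.exists_max_image (fun j ↦ v (f j)) ⟨i, hi⟩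
  by_cases h0 : v (f j) = 0
  · exact ((hmax i hi).trans h0.le).trans zero_le
  refine (hmax i hi).trans (v.map_sum_eq_of_lt hj fun k hk ↦ ?_).ge
  rw [Finset.mem_sdiff, Finset.mem_singleton] at hk
  exact (hmax k hk.1).lt_of_ne fun e ↦ h0 (h j hj k hk.1 (Ne.symm hk.2) e.symm)

/-- Let `b` be a basis of a field extension of degree `p`, with `p`-th powers `1, a, …, a ^ (p - 1)`
for some `a` whose value is not a `p`-th power. Then the coordinates of an integral element satisfy
the evident integrality conditions. -/
theorem repr_pow_mul_mem_range_of_isIntegral {V : Type u} [CommRing V] [IsDomain V]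
    [ValuationRing V] {L : Type*} [Field L] [Algebra V L] [Algebra (FractionRing V) L]
    [IsScalarTower V (FractionRing V) L] {p : ℕ} (hp : p.Prime) (a : (FractionRing V)ˣ)
    (ha : ∀ y : ValueGrp V, y ^ p ≠ a) (b : Module.Basis (Fin p) (FractionRing V) L)
    (hb : ∀ i, b i ^ p = algebraMap (FractionRing V) L (a ^ (i : ℕ))) {z : L}
    (hz : IsIntegral V z) (i : Fin p) :
    b.repr z i ^ p * (a : FractionRing V) ^ (i : ℕ) ∈ (algebraMap V (FractionRing V)).range := by
  obtain ⟨W, hW⟩ :=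
    ValuationRing.exists_valuationSubring_comap_eq (V := V) (K := FractionRing V) (L := L)
  have hpow (c : FractionRing V) (i : Fin p) : (c • b i) ^ p =
      algebraMap (FractionRing V) L (c ^ p * (a : FractionRing V) ^ (i : ℕ)) := by
    rw [smul_pow, hb, Algebra.smul_def, map_mul]
  have hdist (i j : Fin p) (hij : i < j) (c d : FractionRing V) (hc : c ≠ 0) (hd : d ≠ 0)
      (h : W.valuation (c • b i) = W.valuation (d • b j)) : False := by
    lift c to (FractionRing V)ˣ using hc.isUnit
    lift d to (FractionRing V)ˣ using hd.isUnit
    have h' : W.valuation (algebraMap (FractionRing V) L ((c ^ p * a ^ (i : ℕ) : (FractionRing V)ˣ)))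
        = W.valuation (algebraMap (FractionRing V) L ((d ^ p * a ^ (j : ℕ) : (FractionRing V)ˣ))) := by
      have := congrArg (· ^ p) h
      simpa only [← map_pow, hpow, Units.val_mul, Units.val_pow_eq_pow_val] using this
    have hone (x y : (FractionRing V)ˣ) (hxy : W.valuation (algebraMap (FractionRing V) L x) =
        W.valuation (algebraMap (FractionRing V) L y)) :
        ((x * y⁻¹ : (FractionRing V)ˣ) : FractionRing V) ∈ (algebraMap V (FractionRing V)).range := by
      rw [← hW, ← W.valuation_le_one_iff, Units.val_mul, map_mul, map_mul, hxy, ← map_mul, ← map_mul,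
        ← Units.val_mul, mul_inv_cancel, Units.val_one, map_one, map_one]
    have hcls := mk_eq_one_of_mem_range (hone _ _ h'.symm) (by
      rw [mul_inv, inv_inv, mul_comm]
      exact hone _ _ h')
    rw [QuotientGroup.mk_mul, QuotientGroup.mk_inv, mul_inv_eq_one, QuotientGroup.mk_mul,
      QuotientGroup.mk_mul, QuotientGroup.mk_pow, QuotientGroup.mk_pow, QuotientGroup.mk_pow,
      QuotientGroup.mk_pow] at hcls
    obtain ⟨y, hy⟩ := exists_pow_eq_of_mul_pow_eq (G := ValueGrp V) hp hij j.2 hcls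
    exact ha y hy
  have hzW : z ∈ W := by
    have hV (v : V) : algebraMap V L v ∈ W := by
      rw [IsScalarTower.algebraMap_apply V (FractionRing V) L]
      exact (hW _).mpr ⟨v, rfl⟩
    obtain ⟨P, hP, hPz⟩ := hz
    have hint : IsIntegral W z :=
      ⟨P.map ((algebraMap V L).codRestrict W hV), hP.map _, by rwa [Polynomial.eval₂_map]⟩
    obtain ⟨w, rfl⟩ := IsIntegrallyClosed.isIntegral_iff.mp hint
    exact w.2
  rw [← hW, ← hpow]
  refine pow_mem ?_ p
  rw [← W.valuation_le_one_iff] at hzW ⊢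
  refine le_trans ?_ hzW
  conv_rhs => rw [← b.sum_repr z]
  refine W.valuation.map_le_map_sum_of_pairwise_ne Finset.univ (fun i ↦ b.repr z i • b i) ?_
    (Finset.mem_univ i)
  intro j _ k _ hjk h
  by_contra hj
  have hk : W.valuation (b.repr z k • b k) ≠ 0 := h ▸ hj
  have hj0 : b.repr z j ≠ 0 := fun h0 ↦ hj (by simp [h0])
  have hk0 : b.repr z k ≠ 0 := fun h0 ↦ hk (by simp [h0])
  rcases lt_or_gt_of_ne hjk with hlt | hlt
  · exact hdist j k hlt _ _ hj0 hk0 h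
  · exact hdist k j hlt _ _ hk0 hj0 h.symm

/-- Let `V` be a valuation ring whose value group `Γ = K^×/V^×` has a smallest
element `ε` greater than the identity, such that `Γ/⟨ε⟩` is not divisible,
i.e. there are `γ ∈ Γ` and a prime `p` with `γ` not in the subgroup generated
by the `p`-th powers of `Γ` together with `ε`.  Then `V` is not N-2. -/
theorem not_isN2_of_smallest_element_not_divisible
    (V : Type u) [CommRing V] [IsDomain V] [ValuationRing V]
    (ε : ValueGrp V)
    (hε : vle V 1 ε ∧ ε ≠ 1)
    (hmin : ∀ δ : ValueGrp V, (vle V 1 δ ∧ δ ≠ 1) → vle V ε δ)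
    (hnondiv : ∃ (γ : ValueGrp V) (p : ℕ), p.Prime ∧
      γ ∉ Subgroup.closure ({x : ValueGrp V | ∃ y : ValueGrp V, y ^ p = x} ∪ {ε})) :
    ¬ IsN2 V := by
  intro hN2
  obtain ⟨γ, p, hp, hγ⟩ := hnondiv
  obtain ⟨a, rfl⟩ := QuotientGroup.mk_surjective γ
  obtain ⟨t, rfl⟩ := QuotientGroup.mk_surjective ε
  have ha (y : ValueGrp V) : y ^ p ≠ a := fun h ↦
    hγ (Subgroup.subset_closure (Or.inl ⟨y, h⟩))
  have hirr : Irreducible (Polynomial.X ^ p - Polynomial.C (a : FractionRing V)) := by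
    refine X_pow_sub_C_irreducible_of_prime hp fun c hc ↦ ?_
    have hc0 : c ≠ 0 := by
      rintro rfl
      exact a.ne_zero (by rw [← hc, zero_pow hp.ne_zero])
    refine ha (Units.mk0 c hc0 : (FractionRing V)ˣ) ?_
    rw [← QuotientGroup.mk_pow]
    exact congrArg _ (Units.ext (by simpa using hc))
  have : Fact (Irreducible (Polynomial.X ^ p - Polynomial.C (a : FractionRing V))) := ⟨hirr⟩
  let L := AdjoinRoot (Polynomial.X ^ p - Polynomial.C (a : FractionRing V))
  let pb : PowerBasis (FractionRing V) L := AdjoinRoot.powerBasis hirr.ne_zero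
  have hdim : pb.dim = p := by
    rw [AdjoinRoot.powerBasis_dim, Polynomial.natDegree_X_pow_sub_C]
  have hgen : pb.gen ^ p = algebraMap (FractionRing V) L a := by
    have := AdjoinRoot.eval₂_root (Polynomial.X ^ p - Polynomial.C (a : FractionRing V))
    rw [Polynomial.eval₂_sub, Polynomial.eval₂_X_pow, Polynomial.eval₂_C, sub_eq_zero] at this
    rw [AdjoinRoot.powerBasis_gen]
    exact this
  let b : Module.Basis (Fin p) (FractionRing V) L := pb.basis.reindex (finCongr hdim)
  have hb (i : Fin p) : b i ^ p =
      algebraMap (FractionRing V) L ((a : FractionRing V) ^ (i : ℕ)) := by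
    simp only [b, Module.Basis.reindex_apply, PowerBasis.basis_eq_pow]
    rw [pow_right_comm, hgen, map_pow]
    rfl
  have hfin : Module.Finite V (integralClosure V L) := hN2 L pb.finite
  let i : Fin p := ⟨1, hp.one_lt⟩
  obtain ⟨c, hc⟩ := ValuationRing.exists_eq_span_singleton_of_fg
    ((Subalgebra.toSubmodule (integralClosure V L)).map ((b.coord i).restrictScalars V))
    ((Module.Finite.iff_fg.mp hfin).map _)
  have hmem (x : FractionRing V) : x ∈ Submodule.span V {c} ↔
      x ^ p * a ∈ (algebraMap V (FractionRing V)).range := by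
    rw [← hc]
    constructor
    · rintro ⟨z, hz, rfl⟩
      simpa [i] using repr_pow_mul_mem_range_of_isIntegral hp a ha b hb hz i
    · rintro ⟨v, hv⟩
      refine ⟨x • b i, ?_, by simp⟩
      refine IsIntegral.of_pow hp.pos ?_
      rw [smul_pow, hb, Algebra.smul_def, ← map_mul, pow_one, ← hv,
        ← IsScalarTower.algebraMap_apply]
      exact isIntegral_algebraMap
  have hc0 : c ≠ 0 := by
    rintro rfl
    obtain ⟨n, d, hd, had⟩ := IsFractionRing.div_surjective (A := V) (a : FractionRing V)
    have hd0 : algebraMap V (FractionRing V) d ≠ 0 := by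
      simpa using nonZeroDivisors.ne_zero hd
    have := (hmem (algebraMap V (FractionRing V) d)).mpr ⟨d ^ (p - 1) * n, by
      rw [← had, map_mul, map_pow]
      nth_rw 2 [← Nat.sub_add_cancel hp.one_le]
      rw [pow_succ]
      field_simp⟩
    exact hd0 (by simpa using this)
  lift c to (FractionRing V)ˣ using hc0.isUnit
  have hca := (hmem c).mp (Submodule.mem_span_singleton_self _)
  have hct : (((c * t⁻¹) ^ p * a : (FractionRing V)ˣ) : FractionRing V) ∉
      (algebraMap V (FractionRing V)).range := by
    intro h
    obtain ⟨v, hv⟩ := Submodule.mem_span_singleton.mp ((hmem (c * t⁻¹ : (FractionRing V)ˣ)).mpr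
      (by simpa using h))
    refine hε.2 (mk_eq_one_of_mem_range (by simpa using (vle_mk_iff 1 t).mp hε.1) ⟨v, ?_⟩)
    rw [Algebra.smul_def, Units.val_mul, mul_comm] at hv
    exact mul_left_cancel₀ c.ne_zero hv
  have hzp := mk_mem_zpowers_of_dvd_pow t hmin p (c ^ p * a) (by simpa using hca) (by
    rcases ValuationRing.isInteger_or_isInteger V
      (((c * t⁻¹) ^ p * a : (FractionRing V)ˣ) : FractionRing V) with h | h
    · exact absurd h hct
    · rw [← Units.val_inv_eq_inv_val] at h
      have heq : ((c * t⁻¹) ^ p * a)⁻¹ = t ^ p * (c ^ p * a)⁻¹ := by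
        rw [mul_pow, mul_inv, mul_inv, mul_inv, inv_pow t, inv_inv]
        ac_rfl
      rwa [heq] at h)
  refine hγ ?_
  have hprod : (a : ValueGrp V) =
      ((QuotientGroup.mk c : ValueGrp V)⁻¹) ^ p * ((c ^ p * a : (FractionRing V)ˣ) : ValueGrp V) := by
    rw [QuotientGroup.mk_mul, QuotientGroup.mk_pow, inv_pow, inv_mul_cancel_left]
  rw [hprod]
  refine mul_mem (Subgroup.subset_closure (Or.inl ⟨_, rfl⟩)) ?_
  exact (Subgroup.zpowers_le (G := ValueGrp V)).mpr (Subgroup.subset_closure (Or.inr rfl)) hzp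
end
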